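/- arXiv:1907.08430 — 3 statements merged into one kernel-verified Lean document; each statement's English description precedes it below -/
import Mathlib

section
/- Let G be a d-regular finite simple graph of order n with d ≥ 1. Then 2·γ_rd(G) = n if and only if 2d·γ_rk(G) = k·n holds for every integer k with d ≤ k ≤ 2d. -/
open SimpleGraph Finset

/-- `f` is a `k`-rainbow dominating function on `G`: every vertex with empty color set
has, for each color, a neighbour carrying that color. -/
def IsKRDF {V : Type*} (G : SimpleGraph V) (k : ℕ) (f : V → Finset (Fin k)) : Prop :=
  ∀ v : V, f v = ∅ → ∀ i : Fin k, ∃ u : V, G.Adj v u ∧ i ∈ f u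

/-- The weight of a rainbow coloring function. -/
def rdfWeight {V : Type*} [Fintype V] {k : ℕ} (f : V → Finset (Fin k)) : ℕ :=
  ∑ v : V, (f v).card

/-- The `k`-rainbow domination number of `G`: the minimum weight of a `k`-RDF. -/
noncomputable def rainbowDomNum {V : Type*} [Fintype V] (G : SimpleGraph V) (k : ℕ) : ℕ :=
  sInf {w : ℕ | ∃ f : V → Finset (Fin k), IsKRDF G k f ∧ rdfWeight f = w}


theorem sum_nbr {V : Type*} [Fintype V] (G : SimpleGraph V) [DecidableRel G.Adj]
    (d : ℕ) (hreg : G.IsRegularOfDegree d) (g : V → ℤ) :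
    ∑ v, ∑ u ∈ G.neighborFinset v, g u = d * ∑ u, g u := by
  classical
  have h : ∀ v, ∑ u ∈ G.neighborFinset v, g u = ∑ u, if G.Adj u v then g u else 0 := by
    intro v
    rw [← Finset.sum_filter]
    refine Finset.sum_congr ?_ (fun _ _ => rfl)
    ext u
    simp [G.adj_comm]
  simp_rw [h]
  rw [Finset.sum_comm, Finset.mul_sum]
  refine Finset.sum_congr rfl (fun u _ => ?_)
  rw [← Finset.sum_filter, Finset.sum_const, ← hreg u, nsmul_eq_mul]
  congr 3
  ext w
  simp

theorem weight_eq {V : Type*} [Fintype V] {k : ℕ} (f : V → Finset (Fin k)) :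
    (rdfWeight f : ℤ) = ∑ i, ∑ v, if i ∈ f v then (1 : ℤ) else 0 := by
  unfold rdfWeight
  rw [Finset.sum_comm]
  push_cast
  refine Finset.sum_congr rfl (fun v _ => ?_)
  simp

theorem rdn_mem {V : Type*} [Fintype V] (G : SimpleGraph V) (k : ℕ) :
    ∃ f : V → Finset (Fin k), IsKRDF G k f ∧ rdfWeight f = rainbowDomNum G k := by
  have : {w : ℕ | ∃ f : V → Finset (Fin k), IsKRDF G k f ∧ rdfWeight f = w}.Nonempty := by
    refine ⟨_, fun _ => Finset.univ, ?_, rfl⟩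
    intro v hv i
    have : i ∈ (Finset.univ : Finset (Fin k)) := Finset.mem_univ i
    have hv' : (Finset.univ : Finset (Fin k)) = ∅ := hv
    rw [hv'] at this
    simp at this
  exact Nat.sInf_mem this

theorem rdn_le {V : Type*} [Fintype V] (G : SimpleGraph V) (k : ℕ)
    (f : V → Finset (Fin k)) (hf : IsKRDF G k f) : rainbowDomNum G k ≤ rdfWeight f :=
  Nat.sInf_le ⟨f, hf, rfl⟩

/-- A vertex with no colour sees total weight at least `k`. -/
theorem nbr_weight {V : Type*} [Fintype V] (G : SimpleGraph V) [DecidableRel G.Adj]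
    (k : ℕ) (f : V → Finset (Fin k)) (hf : IsKRDF G k f) (v : V) (hv : f v = ∅) :
    (k : ℤ) ≤ ∑ u ∈ G.neighborFinset v, ((f u).card : ℤ) := by
  classical
  have h1 : (Finset.univ : Finset (Fin k)) ⊆ (G.neighborFinset v).biUnion f := by
    intro i _
    obtain ⟨u, hu, hi⟩ := hf v hv i
    simp only [Finset.mem_biUnion, SimpleGraph.mem_neighborFinset]
    exact ⟨u, hu, hi⟩
  have h2 := (Finset.card_le_card h1).trans Finset.card_biUnion_le
  rw [Finset.card_univ, Fintype.card_fin] at h2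
  exact_mod_cast h2

theorem lower {V : Type*} [Fintype V] (G : SimpleGraph V) [DecidableRel G.Adj]
    (d : ℕ) (hd : 1 ≤ d) (hreg : G.IsRegularOfDegree d) (k : ℕ) (hk : k ≤ 2 * d)
    (f : V → Finset (Fin k)) (hf : IsKRDF G k f) :
    (k : ℤ) * Fintype.card V ≤ 2 * d * rdfWeight f := by
  classical
  have hk' : (k : ℤ) ≤ 2 * d := by exact_mod_cast hk
  let g : V → ℤ := fun u => if f u = ∅ then 0 else 2 * d * (f u).card - k
  have hg0 : ∀ u, 0 ≤ g u := by
    intro u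
    by_cases h : f u = ∅
    · simp [g, h]
    · have : (1 : ℤ) ≤ (f u).card := by
        exact_mod_cast Finset.card_pos.mpr (Finset.nonempty_iff_ne_empty.mpr h)
      simp only [g, h, if_false]
      nlinarith
  have hg1 : ∀ u, 2 * (d : ℤ) * (f u).card - k ≤ g u := by
    intro u
    by_cases h : f u = ∅ <;> simp [g, h]
  have hv : ∀ v, (if f v = ∅ then (d : ℤ) * k else 0) ≤ ∑ u ∈ G.neighborFinset v, g u := by
    intro v
    split_ifs with h
    · have h1 := nbr_weight G k f hf v h
      have h2 : ∑ u ∈ G.neighborFinset v, (2 * (d : ℤ) * (f u).card - k)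
          ≤ ∑ u ∈ G.neighborFinset v, g u := Finset.sum_le_sum (fun u _ => hg1 u)
      rw [Finset.sum_sub_distrib, ← Finset.mul_sum, Finset.sum_const,
        SimpleGraph.card_neighborFinset_eq_degree, hreg v, nsmul_eq_mul] at h2
      have h3 := mul_le_mul_of_nonneg_left h1 (by positivity : (0 : ℤ) ≤ 2 * d)
      linarith
    · exact Finset.sum_nonneg (fun u _ => hg0 u)
  have hs := Finset.sum_le_sum (fun v (_ : v ∈ Finset.univ) => hv v)
  rw [sum_nbr G d hreg g] at hs
  have e : ∑ v, (if f v = ∅ then (d : ℤ) * k else 0) = d * ∑ v, if f v = ∅ then (k : ℤ) else 0 := by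
    rw [Finset.mul_sum]
    exact Finset.sum_congr rfl (fun v _ => by split_ifs <;> simp)
  rw [e] at hs
  have hs' := le_of_mul_le_mul_left hs (by exact_mod_cast hd)
  have e2 : ∑ v, ((2 * (d : ℤ) * (f v).card - k) - g v + if f v = ∅ then (k : ℤ) else 0) = 0 := by
    refine Finset.sum_eq_zero (fun v _ => ?_)
    by_cases h : f v = ∅ <;> simp [g, h]
  rw [Finset.sum_add_distrib, Finset.sum_sub_distrib, Finset.sum_sub_distrib, ← Finset.mul_sum,
    Finset.sum_const, Finset.card_univ, nsmul_eq_mul] at e2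
  have e3 : (rdfWeight f : ℤ) = ∑ v, ((f v).card : ℤ) := by simp [rdfWeight]
  rw [e3]
  linarith

/-- In an optimal `d`-RDF of weight `n/2`, every colour class has size `n/(2d)`. -/
theorem classes {V : Type*} [Fintype V] (G : SimpleGraph V) [DecidableRel G.Adj]
    (d : ℕ) (hreg : G.IsRegularOfDegree d)
    (f : V → Finset (Fin d)) (hf : IsKRDF G d f) (hw : 2 * rdfWeight f = Fintype.card V)
    (i : Fin d) : 2 * (d : ℤ) * (∑ v, if i ∈ f v then (1 : ℤ) else 0) = Fintype.card V := by
  classical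
  have hw' : 2 * (rdfWeight f : ℤ) = Fintype.card V := by exact_mod_cast hw
  have hV0 : (Fintype.card V : ℤ) - rdfWeight f ≤ ∑ v, if f v = ∅ then (1 : ℤ) else 0 := by
    have e3 : (rdfWeight f : ℤ) = ∑ v, ((f v).card : ℤ) := by simp [rdfWeight]
    have e4 : (Fintype.card V : ℤ) = ∑ v : V, (1 : ℤ) := by simp
    rw [e3, e4, ← Finset.sum_sub_distrib]
    refine Finset.sum_le_sum (fun v _ => ?_)
    split_ifs with h
    · simp
    · have : (1 : ℤ) ≤ (f v).card := by
        exact_mod_cast Finset.card_pos.mpr (Finset.nonempty_iff_ne_empty.mpr h)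
      linarith
  have hge : ∀ j : Fin d, (Fintype.card V : ℤ) ≤
      2 * (d : ℤ) * (∑ v, if j ∈ f v then (1 : ℤ) else 0) := by
    intro j
    have h1 : ∑ v, (if f v = ∅ then (1 : ℤ) else 0) ≤
        ∑ v, ∑ u ∈ G.neighborFinset v, if j ∈ f u then (1 : ℤ) else 0 := by
      refine Finset.sum_le_sum (fun v _ => ?_)
      have hnn : ∀ u ∈ G.neighborFinset v, (0 : ℤ) ≤ if j ∈ f u then (1 : ℤ) else 0 := by
        intro u _
        split_ifs <;> simp
      split_ifs with h
      · obtain ⟨u, hu, hj⟩ := hf v h j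
        have := Finset.single_le_sum hnn ((SimpleGraph.mem_neighborFinset G v u).2 hu)
        simpa [hj] using this
      · exact Finset.sum_nonneg hnn
    rw [sum_nbr G d hreg] at h1
    linarith
  have htot : ∑ j : Fin d, (Fintype.card V : ℤ) =
      ∑ j : Fin d, 2 * (d : ℤ) * (∑ v, if j ∈ f v then (1 : ℤ) else 0) := by
    rw [← Finset.mul_sum, ← weight_eq, Finset.sum_const, Finset.card_univ, Fintype.card_fin,
      nsmul_eq_mul, ← hw']
    ring
  exact ((Finset.sum_eq_sum_iff_of_le (fun j _ => hge j)).1 htot i (Finset.mem_univ i)).symm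

/-- A `d`-regular graph `G` of order `n` (`d ≥ 1`) satisfies `2·γ_rd(G) = n`
(i.e. `G` is `d`-rainbow domination regular) if and only if `2d·γ_rk(G) = k·n` for all
`d ≤ k ≤ 2d`. -/
theorem stmt_13 {V : Type*} [Fintype V] (G : SimpleGraph V) [DecidableRel G.Adj]
    (d : ℕ) (hd : 1 ≤ d) (hreg : G.IsRegularOfDegree d) :
    2 * rainbowDomNum G d = Fintype.card V ↔
      ∀ k : ℕ, d ≤ k → k ≤ 2 * d → 2 * d * rainbowDomNum G k = k * Fintype.card V := by
  classical
  constructor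
  · intro h k hdk hk
    apply le_antisymm
    · obtain ⟨f, hf, hw⟩ := rdn_mem G d
      rw [← hw] at h
      let r : Fin k → Fin d := fun j => ⟨j.1 % d, Nat.mod_lt _ hd⟩
      let f' : V → Finset (Fin k) := fun v => Finset.univ.filter (fun j => r j ∈ f v)
      have hf' : IsKRDF G k f' := by
        intro v hv j
        have hv0 : f v = ∅ := by
          rw [Finset.eq_empty_iff_forall_notMem] at hv ⊢
          intro i hi
          apply hv ⟨i.1, i.2.trans_le hdk⟩
          have : r ⟨i.1, i.2.trans_le hdk⟩ = i := Fin.ext (Nat.mod_eq_of_lt i.2)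
          simp [f', this, hi]
        obtain ⟨u, hu, hi⟩ := hf v hv0 (r j)
        exact ⟨u, hu, by simp [f', hi]⟩
      have hwt : 2 * (d : ℤ) * rdfWeight f' = k * Fintype.card V := by
        rw [weight_eq, Finset.mul_sum]
        have : ∀ j : Fin k, 2 * (d : ℤ) * (∑ v, if j ∈ f' v then (1 : ℤ) else 0)
            = Fintype.card V := by
          intro j
          rw [← classes G d hreg f hf h (r j)]
          simp [f']
        rw [Finset.sum_congr rfl (fun j _ => this j)]
        simp
      have hwt' : 2 * d * rdfWeight f' = k * Fintype.card V := by exact_mod_cast hwt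
      rw [← hwt']
      exact Nat.mul_le_mul_left _ (rdn_le G k f' hf')
    · obtain ⟨f, hf, hw⟩ := rdn_mem G k
      rw [← hw]
      exact_mod_cast lower G d hd hreg k hk f hf
  · intro h
    have := h d le_rfl (by omega)
    apply Nat.eq_of_mul_eq_mul_left hd
    rw [← this]
    ring
end

section
/- Let m ≥ 3 and let G = Pr(m) be the m-sided prism graph (the Cartesian/box product of the cycle C_m with K_2), a cubic graph of order n = 2m. Then γ_r4(G) = ⌈4m/3⌉ if m ≡ 0 or 1 (mod 6), and γ_r4(G) = ⌈4m/3⌉ + 1 if m ≡ 2, 3, 4 or 5 (mod 6). -/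
open SimpleGraph Finset

/-- The `m`-sided prism: box product of the cycle `C_m` with `K_2`. -/
def prismGraph (m : ℕ) : SimpleGraph (Fin m × Fin 2) :=
  SimpleGraph.cycleGraph m □ (⊤ : SimpleGraph (Fin 2))


/-! ### Translation between the prism graph and periodic sequences of columns -/

lemma prism_adj_iff {m : ℕ} (x y : Fin m × Fin 2) :
    (prismGraph m).Adj x y ↔
      (((x.1 - y.1).val = 1 ∨ (y.1 - x.1).val = 1) ∧ x.2 = y.2) ∨ (x.2 ≠ y.2 ∧ x.1 = y.1) := by
  unfold prismGraph
  rw [SimpleGraph.boxProd_adj, SimpleGraph.cycleGraph_adj']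
  simp

lemma fin_sub_val_eq_one {m : ℕ} (hm : 3 ≤ m) (a b : Fin m) :
    (a - b).val = 1 ↔ a.val = (b.val + 1) % m := by
  have ha := a.isLt
  have hb := b.isLt
  rw [Fin.val_sub]
  have e1 : (m - b.val + a.val) % m = if b.val ≤ a.val then a.val - b.val else m - b.val + a.val := by
    split_ifs with h
    · rw [show m - b.val + a.val = (a.val - b.val) + m by omega, Nat.add_mod_right,
        Nat.mod_eq_of_lt (by omega)]
    · exact Nat.mod_eq_of_lt (by omega)
  have e2 : (b.val + 1) % m = if b.val + 1 = m then 0 else b.val + 1 := by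
    split_ifs with h
    · rw [h, Nat.mod_self]
    · exact Nat.mod_eq_of_lt (by omega)
  rw [e1, e2]
  split_ifs <;> omega

lemma fin2_ne_succ (s : Fin 2) : s ≠ s + 1 := by revert s; decide

lemma fin2_eq_succ (s t : Fin 2) (h : s ≠ t) : t = s + 1 := by revert s t; decide

/-- Column labels for the explicit constructions: columns `0..5` form the repeating block,
columns `6, 7, ...` form the final block of length `r`. -/
def tab (r : ℕ) (i : ℕ) : Fin 2 → Finset (Fin 4) :=
  if r = 1 then
    [![{2}, ∅], ![∅, {0, 1}], ![{3}, ∅], ![∅, {2}], ![{0, 1}, ∅], ![∅, {3}],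
      ![{2}, {3}]].getD i ![∅, ∅]
  else if i < 6 then
    [![{0, 1}, ∅], ![∅, {2}], ![{3}, ∅], ![∅, {0, 1}], ![{2}, ∅], ![∅, {3}]].getD i ![∅, ∅]
  else if r = 2 then [![{0, 1}, ∅], ![∅, {2, 3}]].getD (i - 6) ![∅, ∅]
  else if r = 3 then [![{0, 1}, ∅], ![∅, {2}], ![{3}, {3}]].getD (i - 6) ![∅, ∅]
  else if r = 4 then [![{0, 1}, ∅], ![∅, {2}], ![{3}, {0}], ![∅, {2, 3}]].getD (i - 6) ![∅, ∅]
  else [![{0, 1}, ∅], ![∅, {2}], ![{3}, ∅], ![∅, {0, 1}], ![{2}, {3}]].getD (i - 6) ![∅, ∅]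

/-- Which labels may follow each other. -/
def lstep (r a b : ℕ) : Prop :=
  b = a + 1 ∨ (a = 5 ∧ b = 0) ∨ (a = 5 + r ∧ b = 0) ∨ (a = 5 + r ∧ b = 6 ∧ 3 ≤ r)

instance (r a b : ℕ) : Decidable (lstep r a b) := by unfold lstep; infer_instance

/-- The local domination condition at the middle one of three consecutive columns. -/
def colOK (a b c : Fin 2 → Finset (Fin 4)) : Prop :=
  ∀ s : Fin 2, b s = ∅ → ∀ x : Fin 4, x ∈ a s ∨ x ∈ b (s + 1) ∨ x ∈ c s

instance (a b c : Fin 2 → Finset (Fin 4)) : Decidable (colOK a b c) := by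
  unfold colOK; infer_instance

set_option synthInstance.maxHeartbeats 200000 in
set_option synthInstance.maxSize 2000 in
set_option maxRecDepth 100000 in
lemma tab_ok : ∀ r < 6, ∀ a < 6 + r, ∀ b < 6 + r, lstep r a b → ∀ c < 6 + r, lstep r b c →
    colOK (tab r a) (tab r b) (tab r c) := by
  decide

/-- The label of column `i`. -/
def lab (k i : ℕ) : ℕ := if i < 6 * k then i % 6 else i - 6 * k + 6

lemma lab_step (k r : ℕ) (hr : r < 6) (hm : 3 ≤ 6 * k + r) (i : ℕ) (hi : i < 6 * k + r) :
    lstep r (lab k i) (lab k ((i + 1) % (6 * k + r))) := by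
  have e2 : (i + 1) % (6 * k + r) = if i + 1 = 6 * k + r then 0 else i + 1 := by
    split_ifs with h
    · rw [h, Nat.mod_self]
    · exact Nat.mod_eq_of_lt (by omega)
  rw [e2]
  unfold lstep lab
  split_ifs <;> omega

lemma lab_lt (k r : ℕ) (i : ℕ) (hi : i < 6 * k + r) : lab k i < 6 + r := by
  unfold lab
  split_ifs <;> omega

lemma sum_block (h : ℕ → ℕ) (k : ℕ) :
    ∑ i ∈ range (6 * k), h (i % 6) = k * ∑ i ∈ range 6, h i := by
  induction k with
  | zero => simp
  | succ k ih =>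
    rw [show 6 * (k + 1) = 6 * k + 6 by ring, Finset.sum_range_add, ih, add_one_mul]
    congr 1
    apply Finset.sum_congr rfl
    intro i hi
    rw [Finset.mem_range] at hi
    congr 1
    omega

/-- Weight of a column. -/
def colW (c : Fin 2 → Finset (Fin 4)) : ℕ := (c 0).card + (c 1).card

lemma sum_lab (h : ℕ → ℕ) (k r : ℕ) :
    ∑ i ∈ range (6 * k + r), h (lab k i) =
      k * ∑ i ∈ range 6, h i + ∑ i ∈ range r, h (i + 6) := by
  rw [Finset.sum_range_add, ← sum_block]
  congr 1
  · apply Finset.sum_congr rfl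
    intro i hi
    rw [Finset.mem_range] at hi
    simp [lab, hi]
  · apply Finset.sum_congr rfl
    intro i hi
    simp [lab]

lemma tab_w : ∀ r < 6, (∑ i ∈ range 6, colW (tab r i) = 8) ∧
    3 * (∑ i ∈ range r, colW (tab r (i + 6))) =
      4 * r + (if r = 0 then 0 else if r = 1 then 2 else if r = 2 then 4 else if r = 3 then 3
        else if r = 4 then 5 else 4) := by
  decide

lemma upper (m k r : ℕ) (hr : r < 6) (hm : 3 ≤ m) (hmdef : m = 6 * k + r) :
    ∃ f : Fin m × Fin 2 → Finset (Fin 4), IsKRDF (prismGraph m) 4 f ∧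
      3 * rdfWeight f = 4 * m +
       (if r = 0 then 0 else if r = 1 then 2 else if r = 2 then 4 else if r = 3 then 3
        else if r = 4 then 5 else 4) := by
  refine ⟨fun p => tab r (lab k p.1.val) p.2, ?_, ?_⟩
  · rintro ⟨i, s⟩ hv x
    have hi := i.isLt
    obtain ⟨j, hj, hji⟩ : ∃ j, j < m ∧ (j + 1) % m = i.val := by
      by_cases h0 : i.val = 0
      · exact ⟨m - 1, by omega, by rw [h0, show m - 1 + 1 = m by omega, Nat.mod_self]⟩
      · exact ⟨i.val - 1, by omega, by
          rw [show i.val - 1 + 1 = i.val by omega, Nat.mod_eq_of_lt hi]⟩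
    have hl : (i.val + 1) % m < m := Nat.mod_lt _ (by omega)
    have s1 := lab_step k r hr (hmdef ▸ hm) j (hmdef ▸ hj)
    have s2 := lab_step k r hr (hmdef ▸ hm) i.val (hmdef ▸ hi)
    rw [← hmdef] at s1 s2
    rw [hji] at s1
    have := tab_ok r hr _ (lab_lt k r j (hmdef ▸ hj)) _ (lab_lt k r i.val (hmdef ▸ hi)) s1 _ (lab_lt k r _ (hmdef ▸ hl)) s2 s hv x
    rcases this with h | h | h
    · refine ⟨(⟨j, hj⟩, s), ?_, h⟩
      rw [prism_adj_iff]
      left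
      refine ⟨Or.inl ?_, rfl⟩
      rw [fin_sub_val_eq_one hm]
      exact hji.symm
    · refine ⟨(i, s + 1), ?_, h⟩
      rw [prism_adj_iff]
      right
      refine ⟨?_, rfl⟩
      exact fin2_ne_succ s
    · refine ⟨(⟨_, hl⟩, s), ?_, h⟩
      rw [prism_adj_iff]
      left
      refine ⟨Or.inr ?_, rfl⟩
      rw [fin_sub_val_eq_one hm]
  · have : rdfWeight (fun p : Fin m × Fin 2 => tab r (lab k p.1.val) p.2) =
        ∑ i ∈ range m, colW (tab r (lab k i)) := by
      unfold rdfWeight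
      rw [Fintype.sum_prod_type, Finset.sum_range]
      simp [colW, Fin.sum_univ_two]
    rw [this, hmdef, sum_lab (fun i => colW (tab r i))]
    obtain ⟨h1, h2⟩ := tab_w r hr
    rw [h1]
    omega

/-! ### Lower bound -/

/-- A periodic sequence of columns satisfying the domination condition. -/
structure Cyc (m : ℕ) (F : ℕ → Fin 2 → Finset (Fin 4)) : Prop where
  per : ∀ i s, F (i + m) s = F i s
  dom : ∀ i s, F (i + 1) s = ∅ → F i s ∪ F (i + 1) (s + 1) ∪ F (i + 2) s = univ

lemma Cyc.shift {m : ℕ} {F : ℕ → Fin 2 → Finset (Fin 4)} (h : Cyc m F) (t : ℕ) :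
    Cyc m (fun i => F (i + t)) := by
  constructor
  · intro i s
    rw [← h.per (i + t) s]; congr 1; omega
  · intro i s hs
    have := h.dom (i + t) s
    rw [show i + t + 1 = i + 1 + t by omega, show i + t + 2 = i + 2 + t by omega] at this
    exact this hs

lemma sum_shift_one {m : ℕ} (g : ℕ → ℕ) (hg : ∀ i, g (i + m) = g i) :
    ∑ i ∈ range m, g (i + 1) = ∑ i ∈ range m, g i := by
  have h1 := Finset.sum_range_succ g m
  have h2 := Finset.sum_range_succ' g m
  have h3 := hg 0
  rw [zero_add] at h3
  omega

lemma sum_shift {m : ℕ} (g : ℕ → ℕ) (hg : ∀ i, g (i + m) = g i) (t : ℕ) :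
    ∑ i ∈ range m, g (i + t) = ∑ i ∈ range m, g i := by
  induction t with
  | zero => simp
  | succ t ih =>
    rw [← ih, ← sum_shift_one (fun i => g (i + t))]
    · apply Finset.sum_congr rfl
      intro i _
      congr 1
      omega
    · intro i
      rw [← hg (i + t)]; congr 1; omega

lemma periodic_all {m : ℕ} (hm : 0 < m) {P : ℕ → Prop} (hP : ∀ i, P (i + m) ↔ P i)
    (h : ∀ i < m, P i) (i : ℕ) : P i := by
  induction i using Nat.strong_induction_on with
  | _ i ih =>
    by_cases hi : i < m
    · exact h i hi
    · have := (hP (i - m)).2 (ih (i - m) (by omega))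
      rwa [Nat.sub_add_cancel (by omega)] at this

/-- Sum of the weights of three consecutive columns. -/
def tri (F : ℕ → Fin 2 → Finset (Fin 4)) (i : ℕ) : ℕ :=
  colW (F i) + colW (F (i + 1)) + colW (F (i + 2))

section
variable {m : ℕ} {F : ℕ → Fin 2 → Finset (Fin 4)}

lemma Cyc.perW (h : Cyc m F) (i : ℕ) : colW (F (i + m)) = colW (F i) := by
  unfold colW; rw [h.per, h.per]

lemma Cyc.perT (h : Cyc m F) (i : ℕ) : tri F (i + m) = tri F i := by
  unfold tri
  rw [h.perW, show i + m + 1 = i + 1 + m by omega, show i + m + 2 = i + 2 + m by omega, h.perW,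
    h.perW]

lemma Cyc.sumT (h : Cyc m F) :
    ∑ i ∈ range m, tri F i = 3 * ∑ i ∈ range m, colW (F i) := by
  unfold tri
  rw [Finset.sum_add_distrib, Finset.sum_add_distrib,
    sum_shift (fun i => colW (F i)) h.perW 1, sum_shift (fun i => colW (F i)) h.perW 2]
  ring

lemma Cyc.dcard (h : Cyc m F) (i : ℕ) (s : Fin 2) (hs : (F (i + 1) s).card = 0) :
    4 ≤ (F i s).card + (F (i + 1) (s + 1)).card + (F (i + 2) s).card := by
  have h1 := h.dom i s (Finset.card_eq_zero.1 hs)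
  have h2 := Finset.card_union_le (F i s ∪ F (i + 1) (s + 1)) (F (i + 2) s)
  have h3 := Finset.card_union_le (F i s) (F (i + 1) (s + 1))
  rw [h1] at h2
  simp at h2
  omega

lemma Cyc.d0 (h : Cyc m F) (i : ℕ) (hs : (F (i + 1) 0).card = 0) :
    4 ≤ (F i 0).card + (F (i + 1) 1).card + (F (i + 2) 0).card := h.dcard i 0 hs

lemma Cyc.d1 (h : Cyc m F) (i : ℕ) (hs : (F (i + 1) 1).card = 0) :
    4 ≤ (F i 1).card + (F (i + 1) 0).card + (F (i + 2) 1).card := h.dcard i 1 hs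

/-- Discharging: every zero column costs at least `3`. -/
lemma Cyc.discharge (h : Cyc m F) :
    4 * m + 3 * ∑ i ∈ range m, (if colW (F i) = 0 then 1 else 0) ≤
      3 * ∑ i ∈ range m, colW (F i) := by
  obtain ⟨z, hz⟩ : ∃ z : ℕ → ℕ, z = fun i => if colW (F i) = 0 then 1 else 0 := ⟨_, rfl⟩
  obtain ⟨a, ha⟩ : ∃ a : ℕ → ℕ, a = fun i =>
    if colW (F i) = 0 ∧ colW (F (i + 1)) ≤ 3 then 1 else 0 := ⟨_, rfl⟩
  obtain ⟨b, hb⟩ : ∃ b : ℕ → ℕ, b = fun i =>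
    if colW (F (i + 1)) = 0 ∧ colW (F i) ≤ 3 then 1 else 0 := ⟨_, rfl⟩
  have hzs : ∑ i ∈ range m, (if colW (F i) = 0 then 1 else 0) = ∑ i ∈ range m, z i := by rw [hz]
  rw [hzs]
  have pz : ∀ i, z (i + m) = z i := by intro i; simp only [hz, h.perW]
  have e1 : ∀ i, i + m + 1 = i + 1 + m := by intro i; omega
  have pa : ∀ i, a (i + m) = a i := by intro i; simp only [ha, e1, h.perW]
  have pb : ∀ i, b (i + m) = b i := by intro i; simp only [hb, e1, h.perW]
  have vz : ∀ i, (colW (F i) = 0 ∧ z i = 1) ∨ (colW (F i) ≠ 0 ∧ z i = 0) := by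
    intro i; rw [hz]; dsimp only; split_ifs <;> omega
  have va : ∀ i, ((colW (F i) = 0 ∧ colW (F (i + 1)) ≤ 3) ∧ a i = 1) ∨
      (¬(colW (F i) = 0 ∧ colW (F (i + 1)) ≤ 3) ∧ a i = 0) := by
    intro i; rw [ha]; dsimp only; split_ifs <;> omega
  have vb : ∀ i, ((colW (F (i + 1)) = 0 ∧ colW (F i) ≤ 3) ∧ b i = 1) ∨
      (¬(colW (F (i + 1)) = 0 ∧ colW (F i) ≤ 3) ∧ b i = 0) := by
    intro i; rw [hb]; dsimp only; split_ifs <;> omega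
  have l1 : ∀ i, 4 + 4 * z (i + 1) ≤ tri F i + a i + b (i + 1) := by
    intro i
    have d0 := h.d0 i
    have d1 := h.d1 i
    have w1 := vz (i + 1)
    have w2 := va i
    have w3 := vb (i + 1)
    simp only [tri, colW, add_assoc, Nat.reduceAdd] at *
    omega
  have l2 : ∀ i, a (i + 1) + b i ≤ z (i + 1) := by
    intro i
    have d0 := h.d0 i
    have d1 := h.d1 i
    have w1 := vz (i + 1)
    have w2 := va (i + 1)
    have w3 := vb i
    simp only [colW, add_assoc, Nat.reduceAdd] at *
    omega
  have s1 := Finset.sum_le_sum (fun i (_ : i ∈ range m) => l1 i)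
  have s2 := Finset.sum_le_sum (fun i (_ : i ∈ range m) => l2 i)
  simp only [Finset.sum_add_distrib, ← Finset.mul_sum, sum_shift_one z pz, sum_shift_one a pa,
    sum_shift_one b pb, h.sumT] at s1 s2
  simp at s1
  omega

/-- Consequences of total excess at most two. -/
structure Tight (m : ℕ) (F : ℕ → Fin 2 → Finset (Fin 4)) : Prop extends Cyc m F where
  hm : 3 ≤ m
  ub : 3 * ∑ i ∈ range m, colW (F i) ≤ 4 * m + 2

lemma Tight.shift (h : Tight m F) (t : ℕ) : Tight m (fun i => F (i + t)) := by
  refine ⟨h.toCyc.shift t, h.hm, ?_⟩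
  rw [sum_shift (fun i => colW (F i)) h.toCyc.perW t]
  exact h.ub

lemma Tight.pos (h : Tight m F) (i : ℕ) : 0 < colW (F i) := by
  have hm := h.hm
  refine periodic_all (m := m) (P := fun i => 0 < colW (F i)) (by omega) ?_ ?_ i
  · intro i; simp only [h.toCyc.perW]
  · intro i hi
    by_contra hc
    have h1 := h.toCyc.discharge
    have h2 := Finset.single_le_sum (f := fun i => if colW (F i) = 0 then 1 else 0)
      (fun _ _ => Nat.zero_le _) (Finset.mem_range.2 hi)
    have h3 := h.ub
    simp only [show colW (F i) = 0 by omega, if_true] at h2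
    omega

lemma Tight.T4 (h : Tight m F) (i : ℕ) : 4 ≤ tri F i := by
  have d0 := h.toCyc.d0 i
  have d1 := h.toCyc.d1 i
  have p0 := h.pos i
  have p1 := h.pos (i + 1)
  have p2 := h.pos (i + 2)
  unfold tri
  unfold colW at *
  omega

lemma Tight.sumE (h : Tight m F) :
    ∑ i ∈ range m, (tri F i - 4) + 4 * m = 3 * ∑ i ∈ range m, colW (F i) := by
  rw [← h.toCyc.sumT]
  have : ∑ i ∈ range m, tri F i = ∑ i ∈ range m, ((tri F i - 4) + 4) := by
    apply Finset.sum_congr rfl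
    intro i _
    have := h.T4 i
    omega
  rw [this, Finset.sum_add_distrib]
  simp
  ring

/-- The excess over any set of positions is at most the total excess. -/
lemma Tight.sub (h : Tight m F) (S : Finset ℕ) (hS : S ⊆ range m) :
    ∑ i ∈ S, (tri F i - 4) + 4 * m ≤ 3 * ∑ i ∈ range m, colW (F i) := by
  rw [← h.sumE]
  have := Finset.sum_le_sum_of_subset (f := fun i => tri F i - 4) hS
  omega

lemma Tight.three (h : Tight m F) (t : ℕ) :
    tri F t + tri F (t + 1) + tri F (t + 2) ≤ 14 := by
  have h' := h.shift t
  have hm := h.hm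
  have h1 := h'.sub {0, 1, 2} (by intro x; simp; omega)
  have h2 := h'.ub
  simp at h1
  have e : ∀ i, tri (fun i => F (i + t)) i = tri F (i + t) := by
    intro i; unfold tri; simp only [show i + t + 1 = i + 1 + t by omega,
      show i + t + 2 = i + 2 + t by omega]
  simp only [e] at h1
  rw [show 0 + t = t by omega, show 1 + t = t + 1 by omega, show 2 + t = t + 2 by omega] at h1
  have := h.T4 t
  have := h.T4 (t + 1)
  have := h.T4 (t + 2)
  omega

/-- No two consecutive columns have an empty vertex in the same row. -/
lemma Tight.alt0 (h : Tight m F) (i : ℕ) (h0 : (F i 0).card = 0) : (F (i + 1) 0).card ≠ 0 := by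
  intro h1
  have key : ∀ j, (F (j + 2) 0).card = 0 → (F (j + 3) 0).card = 0 → False := by
    intro j h0 h1
    have t := h.three j
    have t4 := h.T4 j
    have d0 := h.toCyc.d0 (j + 1)
    have d1 := h.toCyc.d0 (j + 2)
    have p0 := h.pos j
    have p1 := h.pos (j + 1)
    have p2 := h.pos (j + 2)
    have p3 := h.pos (j + 3)
    have p4 := h.pos (j + 4)
    simp only [tri, colW, add_assoc, Nat.reduceAdd] at *
    omega
  have hm := h.hm
  apply key (i + m - 2)
  · rw [show i + m - 2 + 2 = i + m by omega, h.toCyc.per]; exact h0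
  · rw [show i + m - 2 + 3 = i + 1 + m by omega, h.toCyc.per]; exact h1

lemma Tight.alt1 (h : Tight m F) (i : ℕ) (h0 : (F i 1).card = 0) : (F (i + 1) 1).card ≠ 0 := by
  intro h1
  have key : ∀ j, (F (j + 2) 1).card = 0 → (F (j + 3) 1).card = 0 → False := by
    intro j h0 h1
    have t := h.three j
    have t4 := h.T4 j
    have d0 := h.toCyc.d1 (j + 1)
    have d1 := h.toCyc.d1 (j + 2)
    have p0 := h.pos j
    have p1 := h.pos (j + 1)
    have p2 := h.pos (j + 2)
    have p3 := h.pos (j + 3)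
    have p4 := h.pos (j + 4)
    simp only [tri, colW, add_assoc, Nat.reduceAdd] at *
    omega
  have hm := h.hm
  apply key (i + m - 2)
  · rw [show i + m - 2 + 2 = i + m by omega, h.toCyc.per]; exact h0
  · rw [show i + m - 2 + 3 = i + 1 + m by omega, h.toCyc.per]; exact h1

/-- Three sets partition the set of colours. -/
def ColPart (a b c : Finset (Fin 4)) : Prop :=
  a ∪ b ∪ c = univ ∧ a.card + b.card + c.card = 4

lemma part_facts {a b c : Finset (Fin 4)} (h : ColPart a b c) :
    Disjoint a b ∧ Disjoint a c ∧ Disjoint b c := by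
  obtain ⟨h1, h2⟩ := h
  revert a b c
  intro a b c h1 h2
  have c1 := Finset.card_union_le (a ∪ b) c
  have c2 := Finset.card_union_le a b
  have c3 := Finset.card_union_add_card_inter a b
  have c4 := Finset.card_union_add_card_inter (a ∪ b) c
  have c5 : (univ : Finset (Fin 4)).card = 4 := rfl
  rw [h1, c5] at c1 c4
  have i1 : (a ∩ b).card = 0 := by omega
  have i2 : ((a ∪ b) ∩ c).card = 0 := by omega
  rw [Finset.card_eq_zero, ← Finset.disjoint_iff_inter_eq_empty] at i1 i2
  rw [Finset.disjoint_union_left] at i2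
  exact ⟨i1, i2.1, i2.2⟩

lemma part_eq {a b c d : Finset (Fin 4)} (h : ColPart a b c) (h' : ColPart b c d) : d = a := by
  obtain ⟨p1, p2, p3⟩ := part_facts h
  obtain ⟨q1, q2, q3⟩ := part_facts h'
  have h1 := h.1
  have h2 := h'.1
  ext x
  have m1 : x ∈ a ∪ b ∪ c := by rw [h1]; simp
  have m2 : x ∈ b ∪ c ∪ d := by rw [h2]; simp
  rw [Finset.disjoint_left] at *
  simp only [Finset.mem_union] at m1 m2
  have := @p1 x; have := @p2 x; have := @q2 x; have := @q3 x
  tauto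

/-- If all triples starting at `a, ..., b` are partitions, the sequence is 3-periodic there. -/
lemma part_period {B : ℕ → Finset (Fin 4)} {a b : ℕ}
    (h : ∀ i, a ≤ i → i ≤ b → ColPart (B i) (B (i + 1)) (B (i + 2))) (i t : ℕ) (hi : a ≤ i)
    (ht : i + 3 * t ≤ b + 2) : B (i + 3 * t) = B i := by
  induction t with
  | zero => rfl
  | succ t ih =>
    rw [← ih (by omega)]
    have h1 := h (i + 3 * t) (by omega) (by omega)
    have h2 := h (i + 3 * t + 1) (by omega) (by omega)
    exact part_eq h1 h2

lemma disj_self {a b : Finset (Fin 4)} (h : Disjoint a b) (e : a = b) (hp : 0 < a.card) :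
    False := by
  subst e
  simp at h
  subst h
  simp at hp

lemma fin2_cases (s : Fin 2) : s = 0 ∨ s = 1 := by revert s; decide

lemma colW_eq (c : Fin 2 → Finset (Fin 4)) (s : Fin 2) :
    colW c = (c s).card + (c (s + 1)).card := by
  rcases fin2_cases s with rfl | rfl
  · rfl
  · exact add_comm _ _

lemma tri_shift (F : ℕ → Fin 2 → Finset (Fin 4)) (i t : ℕ) :
    tri (fun i => F (i + t)) i = tri F (i + t) := by
  unfold tri; simp only [show i + t + 1 = i + 1 + t by omega,
      show i + t + 2 = i + 2 + t by omega]

/-- Union of the two sets in a column. -/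
def colU (c : Fin 2 → Finset (Fin 4)) : Finset (Fin 4) := c 0 ∪ c 1

lemma colU_card (c : Fin 2 → Finset (Fin 4)) (hc : ∃ s, c s = ∅) : (colU c).card = colW c := by
  unfold colU colW
  obtain ⟨s, hs⟩ := hc
  rcases fin2_cases s with rfl | rfl <;> simp [hs]

lemma Cyc.cover (h : Cyc m F) (i : ℕ) (hc : ∃ s, F (i + 1) s = ∅) :
    colU (F i) ∪ colU (F (i + 1)) ∪ colU (F (i + 2)) = univ := by
  obtain ⟨s, hs⟩ := hc
  have := h.dom i s hs
  rw [Finset.eq_univ_iff_forall] at *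
  intro x
  have := this x
  simp only [colU, Finset.mem_union] at *
  rcases fin2_cases s with rfl | rfl
  · have e : (0 : Fin 2) + 1 = 1 := rfl
    rw [e] at this
    tauto
  · have e : (1 : Fin 2) + 1 = 0 := rfl
    rw [e] at this
    tauto

lemma Tight.part (h : Tight m F) (hs : ∀ i, ∃ s, F i s = ∅) (i : ℕ) (hi : tri F i = 4) :
    ColPart (colU (F i)) (colU (F (i + 1))) (colU (F (i + 2))) := by
  refine ⟨h.toCyc.cover i (hs _), ?_⟩
  rw [colU_card _ (hs _), colU_card _ (hs _), colU_card _ (hs _)]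
  exact hi

/-- The parity argument. -/
lemma Tight.parity (h : Tight m F) (hs : ∀ i, ∃ s, F i s = ∅) : Even m := by
  have step : ∀ i, F (i + 1) 0 = ∅ ↔ ¬ F i 0 = ∅ := by
    intro i
    have a0 := h.alt0 i
    have a1 := h.alt1 i
    simp only [Finset.card_eq_zero, ne_eq] at a0 a1
    constructor
    · intro h1 h2; exact a0 h2 h1
    · intro h1
      obtain ⟨s, hs1⟩ := hs i
      obtain ⟨s', hs2⟩ := hs (i + 1)
      rcases fin2_cases s with rfl | rfl
      · exact absurd hs1 h1
      · rcases fin2_cases s' with rfl | rfl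
        · exact hs2
        · exact absurd hs2 (a1 hs1)
  have all : ∀ j, (F j 0 = ∅ ↔ (F 0 0 = ∅ ↔ Even j)) := by
    intro j
    induction j with
    | zero => simp
    | succ j ih => rw [step, ih, Nat.even_add_one]; tauto
  have h1 := all m
  have h2 := h.toCyc.per 0 0
  rw [zero_add] at h2
  rw [h2] at h1
  tauto

/-- There is a position with positive excess, which we may shift to the end. -/
lemma Tight.exists_excess (h : Tight m F) (hE : 4 * m < 3 * ∑ i ∈ range m, colW (F i)) :
    ∃ i, 5 ≤ tri F i := by
  by_contra hc
  push Not at hc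
  have h1 := h.sumE
  rw [Finset.sum_eq_zero] at h1
  · omega
  · intro i _
    have := hc i
    omega

/-- No double columns, excess one, is impossible. -/
lemma Tight.single_one (h : Tight m F) (hs : ∀ i, ∃ s, F i s = ∅)
    (hE : 3 * ∑ i ∈ range m, colW (F i) = 4 * m + 1) : False := by
  have hm := h.hm
  obtain ⟨i0, hi0⟩ := h.exists_excess (by omega)
  set G : ℕ → Fin 2 → Finset (Fin 4) := fun i => F (i + (i0 + 1)) with hG
  have hGT : Tight m G := h.shift _
  have hsG : ∀ i, ∃ s, G i s = ∅ := fun i => hs _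
  have hEG : 3 * ∑ i ∈ range m, colW (G i) = 4 * m + 1 := by
    rw [← hE, ← sum_shift (fun i => colW (F i)) h.toCyc.perW (i0 + 1)]
  have hlast : 5 ≤ tri G (m - 1) := by
    rw [hG, tri_shift, show m - 1 + (i0 + 1) = i0 + m by omega, h.toCyc.perT]
    exact hi0
  have hother : ∀ i < m - 1, tri G i = 4 := by
    intro i hi
    have h1 := hGT.sub {i, m - 1} (by intro x; simp; omega)
    rw [Finset.sum_pair (by omega)] at h1
    have := hGT.T4 i
    omega
  have hP : ∀ i, 0 ≤ i → i ≤ m - 2 → ColPart (colU (G i)) (colU (G (i + 1))) (colU (G (i + 2))) :=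
    fun i _ hi => hGT.part hsG i (hother i (by omega))
  have hmod : m % 3 = 2 := by omega
  have e1 := part_period (B := fun i => colU (G i)) hP 2 ((m - 2) / 3) (by omega) (by omega)
  rw [show 2 + 3 * ((m - 2) / 3) = m by omega] at e1
  have e2 : colU (G m) = colU (G 0) := by
    have a := hGT.toCyc.per 0 0
    have b := hGT.toCyc.per 0 1
    rw [zero_add] at a b
    simp only [colU, a, b]
  obtain ⟨_, d, _⟩ := part_facts (hP 0 le_rfl (by omega))
  refine disj_self d ?_ ?_
  · rw [← e2]; exact e1
  · rw [colU_card _ (hsG _)]; exact hGT.pos 0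

/-- No double columns, excess two, is impossible. -/
lemma Tight.single_two (h : Tight m F) (hs : ∀ i, ∃ s, F i s = ∅)
    (hE : 3 * ∑ i ∈ range m, colW (F i) = 4 * m + 2) : False := by
  have hm := h.hm
  obtain ⟨i0, hi0⟩ := h.exists_excess (by omega)
  set G : ℕ → Fin 2 → Finset (Fin 4) := fun i => F (i + (i0 + 1)) with hG
  have hGT : Tight m G := h.shift _
  have hsG : ∀ i, ∃ s, G i s = ∅ := fun i => hs _
  have hEG : 3 * ∑ i ∈ range m, colW (G i) = 4 * m + 2 := by
    rw [← hE, ← sum_shift (fun i => colW (F i)) h.toCyc.perW (i0 + 1)]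
  have hlast : 5 ≤ tri G (m - 1) := by
    rw [hG, tri_shift, show m - 1 + (i0 + 1) = i0 + m by omega, h.toCyc.perT]
    exact hi0
  have hmod : m % 3 = 1 := by omega
  have hper : ∀ j, colU (G (j + m)) = colU (G j) := by
    intro j
    simp only [colU, hGT.toCyc.per]
  have hm0 : colU (G m) = colU (G 0) := by
    have := hper 0
    rwa [zero_add] at this
  have hpos : ∀ j, 0 < (colU (G j)).card := by
    intro j
    rw [colU_card _ (hsG _)]; exact hGT.pos j
  by_cases hall : ∀ i < m - 1, tri G i = 4
  · have hP : ∀ i, 0 ≤ i → i ≤ m - 2 → ColPart (colU (G i)) (colU (G (i + 1))) (colU (G (i + 2))) :=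
      fun i _ hi => hGT.part hsG i (hall i (by omega))
    have e1 := part_period (B := fun i => colU (G i)) hP 1 ((m - 1) / 3) (by omega) (by omega)
    rw [show 1 + 3 * ((m - 1) / 3) = m by omega] at e1
    obtain ⟨d, _, _⟩ := part_facts (hP 0 le_rfl (by omega))
    exact disj_self d (by rw [← hm0]; exact e1) (hpos 0)
  · push Not at hall
    obtain ⟨j, hj, hj5⟩ := hall
    have hj4 := hGT.T4 j
    have hother : ∀ i < m - 1, i ≠ j → tri G i = 4 := by
      intro i hi hij
      have h1 := hGT.sub {i, j, m - 1} (by intro x; simp; omega)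
      rw [Finset.sum_insert (by simp; omega), Finset.sum_pair (by omega)] at h1
      have := hGT.T4 i
      omega
    have hP : ∀ i, i < m - 1 → i ≠ j → ColPart (colU (G i)) (colU (G (i + 1))) (colU (G (i + 2))) :=
      fun i hi hij => hGT.part hsG i (hother i hi hij)
    have hP2 : ∀ i, j + 1 ≤ i → i ≤ m - 2 →
        ColPart (colU (G i)) (colU (G (i + 1))) (colU (G (i + 2))) :=
      fun i h1 h2 => hP i (by omega) (by omega)
    have cov : ∀ i, colU (G i) ∪ colU (G (i + 1)) ∪ colU (G (i + 2)) = univ :=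
      fun i => hGT.toCyc.cover i (hsG _)
    have r2 : ∀ i t, j + 1 ≤ i → i + 3 * t ≤ m → colU (G (i + 3 * t)) = colU (G i) :=
      fun i t h1 h2 => part_period (B := fun i => colU (G i)) hP2 i t h1 (by omega)
    have r1 : ∀ i t, i + 3 * t ≤ j + 1 → colU (G (i + 3 * t)) = colU (G i) := by
      intro i t h1
      by_cases hj0 : j = 0
      · have : t = 0 := by omega
        subst this; rfl
      · exact part_period (B := fun i => colU (G i)) (a := 0) (b := j - 1)
          (fun i _ h2 => hP i (by omega) (by omega)) i t (by omega) (by omega)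
    have hcase : (j + 1) % 3 = 0 ∨ (j + 1) % 3 = 1 ∨ (j + 1) % 3 = 2 := by omega
    rcases hcase with hc | hc | hc
    · -- the first segment has length divisible by three
      have e1 := r1 0 ((j + 1) / 3) (by omega)
      rw [show 0 + 3 * ((j + 1) / 3) = j + 1 by omega] at e1
      by_cases hjm : j = m - 2
      · have c := cov (m - 1)
        rw [show m - 1 + 1 = m by omega, show m - 1 + 2 = 1 + m by omega, hper, hm0,
          show m - 1 = j + 1 by omega, e1, Finset.union_self] at c
        have c1 := Finset.card_union_le (colU (G 0)) (colU (G 1))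
        rw [c] at c1
        have c2 := (hP 0 (by omega) (by omega)).2
        have c3 := hpos 2
        simp at c1 c2
        omega
      · have e2 := r2 (j + 2) ((m - j - 2) / 3) (by omega) (by omega)
        rw [show j + 2 + 3 * ((m - j - 2) / 3) = m by omega, hm0] at e2
        obtain ⟨d, _, _⟩ := part_facts (hP2 (j + 1) le_rfl (by omega))
        exact disj_self d (by rw [e1]; exact e2) (hpos _)
    · -- the second segment has length divisible by three
      have e1 := r2 (j + 1) ((m - j - 1) / 3) (by omega) (by omega)
      rw [show j + 1 + 3 * ((m - j - 1) / 3) = m by omega, hm0] at e1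
      by_cases hj0 : j = 0
      · subst hj0
        have c := cov 0
        rw [e1, Finset.union_self] at c
        have c1 := Finset.card_union_le (colU (G (0 + 1))) (colU (G (0 + 2)))
        rw [c] at c1
        have c2 := (hP 1 (by omega) (by omega)).2
        have c3 := hpos 3
        simp at c1 c2
        omega
      · have e2 := r1 1 (j / 3) (by omega)
        rw [show 1 + 3 * (j / 3) = j + 1 by omega] at e2
        obtain ⟨d, _, _⟩ := part_facts (hP 0 (by omega) (by omega))
        exact disj_self d (by rw [e1]; exact e2) (hpos _)
    · -- both segments have length two modulo three
      have e1 := r1 2 ((j - 1) / 3) (by omega)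
      rw [show 2 + 3 * ((j - 1) / 3) = j + 1 by omega] at e1
      have e2 := r1 1 ((j - 1) / 3) (by omega)
      rw [show 1 + 3 * ((j - 1) / 3) = j by omega] at e2
      have e3 := r2 (j + 3) ((m - j - 3) / 3) (by omega) (by omega)
      rw [show j + 3 + 3 * ((m - j - 3) / 3) = m by omega, hm0] at e3
      have p0 := hP 0 (by omega) (by omega)
      have p1 := hP2 (j + 1) le_rfl (by omega)
      rw [show j + 1 + 1 = j + 2 from rfl, show j + 1 + 2 = j + 3 from rfl, e1, ← e3] at p1
      -- `B 1, B 2, B 0` is also a partition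
      have p2 : ColPart (colU (G 1)) (colU (G 2)) (colU (G 0)) := by
        obtain ⟨u, v⟩ := p0
        simp only [zero_add] at u v
        refine ⟨?_, by omega⟩
        rw [← u, Finset.union_comm, Finset.union_assoc]
      have p3 : ColPart (colU (G 2)) (colU (G 0)) (colU (G (j + 2))) := by
        obtain ⟨u, v⟩ := p1
        refine ⟨?_, by omega⟩
        rw [← u, Finset.union_assoc, Finset.union_assoc, Finset.union_comm (colU (G 0))]
      have e4 := part_eq p2 p3
      have c := cov j
      rw [e1, e2, e4] at c
      have c1 := Finset.card_union_le (colU (G 1)) (colU (G 2))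
      rw [Finset.union_comm, ← Finset.union_assoc, Finset.union_self] at c
      rw [c] at c1
      have c2 := p0.2
      have c3 := hpos 0
      simp at c1 c2
      omega

/-- A double column costs two units of excess and, for `m ≡ 4 (mod 6)`, is impossible. -/
lemma Tight.double (h : Tight m F) (hd : ∃ i, ∀ s, F i s ≠ ∅) :
    3 * ∑ i ∈ range m, colW (F i) = 4 * m + 2 ∧ m % 6 ≠ 4 := by
  have hm := h.hm
  obtain ⟨i0, hi0⟩ := hd
  set G : ℕ → Fin 2 → Finset (Fin 4) := fun i => F (i + i0) with hG
  have hT : Tight m G := h.shift _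
  have hEG : ∑ i ∈ range m, colW (F i) = ∑ i ∈ range m, colW (G i) := by
    rw [← sum_shift (fun i => colW (F i)) h.toCyc.perW i0]
  rw [hEG]
  have g0 : ∀ s, 0 < (G 0 s).card := by
    intro s
    rw [Finset.card_pos, Finset.nonempty_iff_ne_empty]
    simpa [hG] using hi0 s
  have gm : ∀ s, G m s = G 0 s := by
    intro s
    have := hT.toCyc.per 0 s
    rwa [zero_add] at this
  have gm1 : ∀ s, G (m + 1) s = G 1 s := by
    intro s
    have := hT.toCyc.per 1 s
    rwa [add_comm 1 m] at this
  -- a column next to a double one has a triple sum at least five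
  have nb : ∀ i, (∀ s, 0 < (G i s).card) → 5 ≤ tri G i := by
    intro i hi
    have d0 := hT.toCyc.d0 i
    have d1 := hT.toCyc.d1 i
    have := hi 0
    have := hi 1
    have := hT.pos (i + 2)
    simp only [tri, colW] at *
    omega
  have nb' : ∀ i, (∀ s, 0 < (G (i + 2) s).card) → 5 ≤ tri G i := by
    intro i hi
    have d0 := hT.toCyc.d0 i
    have d1 := hT.toCyc.d1 i
    have := hi 0
    have := hi 1
    have := hT.pos i
    simp only [tri, colW] at *
    omega
  have f0 : 5 ≤ tri G 0 := nb 0 g0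
  have fm : 5 ≤ tri G (m - 2) := by
    apply nb'
    intro s
    rw [show m - 2 + 2 = m by omega, gm]
    exact g0 s
  have hub := hT.ub
  have htot : 3 * ∑ i ∈ range m, colW (G i) = 4 * m + 2 := by
    have h1 := hT.sub {0, m - 2} (by intro x; simp; omega)
    rw [Finset.sum_pair (by omega)] at h1
    omega
  refine ⟨htot, ?_⟩
  intro hmod
  have f05 : tri G 0 = 5 ∧ tri G (m - 2) = 5 := by
    have h1 := hT.sub {0, m - 2} (by intro x; simp; omega)
    rw [Finset.sum_pair (by omega)] at h1
    omega
  have hother : ∀ i < m, i ≠ 0 → i ≠ m - 2 → tri G i = 4 := by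
    intro i hi h0 h2
    have h1 := hT.sub {i, 0, m - 2} (by intro x; simp; omega)
    rw [Finset.sum_insert (by simp; omega), Finset.sum_pair (by omega)] at h1
    have := hT.T4 i
    omega
  -- every other column has an empty vertex
  have single : ∀ i, 1 ≤ i → i < m → ∃ s, G i s = ∅ := by
    intro i h1 h2
    by_contra hc
    push Not at hc
    have hc' : ∀ s, 0 < (G i s).card := by
      intro s
      rw [Finset.card_pos]
      exact hc s
    have a1 := nb i hc'
    have him : i = m - 2 := by
      by_contra hne
      have := hother i h2 (by omega) hne
      omega
    by_cases hm4 : m = 4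
    · subst hm4
      have d0 := hT.toCyc.d0 0
      have d1 := hT.toCyc.d1 0
      have := g0 0
      have := g0 1
      have q0 := hc' 0
      have q1 := hc' 1
      have q2 := hT.pos 1
      have q3 := f05.1
      rw [him] at q0 q1
      simp only [tri, colW, Nat.reduceAdd, Nat.reduceSub, zero_add] at *
      omega
    · have a2 := nb' (i - 2) (by rw [show i - 2 + 2 = i by omega]; exact hc')
      have := hother (i - 2) (by omega) (by omega) (by omega)
      omega
  -- checkerboard rows
  obtain ⟨s0, hs0⟩ := single 1 (by omega) (by omega)
  have alt : ∀ i, ∀ s, G i s = ∅ → G (i + 1) s ≠ ∅ := by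
    intro i s hs hs'
    rcases fin2_cases s with rfl | rfl
    · exact hT.alt0 i (by rw [hs]; rfl) (by rw [hs']; rfl)
    · exact hT.alt1 i (by rw [hs]; rfl) (by rw [hs']; rfl)
  -- `row i` is the row of the empty vertex in column `i`
  set row : ℕ → Fin 2 := fun i => if i % 2 = 1 then s0 else s0 + 1 with hrow
  have row_succ : ∀ i, row (i + 1) = row i + 1 := by
    intro i
    simp only [hrow]
    rcases Nat.mod_two_eq_zero_or_one i with h | h
    · rw [if_pos (by omega), if_neg (by omega)]
      clear_value row
      clear hs0
      clear hrow
      revert s0; decide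
    · rw [if_neg (by omega), if_pos h]
  have fin2_ne : ∀ s t : Fin 2, s ≠ t → s = t + 1 := by decide
  have fin2_add : ∀ s : Fin 2, s + 1 + 1 = s := by decide
  have emp : ∀ i, i + 1 < m → G (i + 1) (row (i + 1)) = ∅ := by
    intro i
    induction i with
    | zero => intro _; simpa [hrow] using hs0
    | succ i ih =>
      intro hi
      have h1 := ih (by omega)
      obtain ⟨t, ht⟩ := single (i + 1 + 1) (by omega) hi
      have : t ≠ row (i + 1) := by
        intro e
        rw [e] at ht
        exact alt _ _ h1 ht
      rw [row_succ (i + 1), ← fin2_ne _ _ this]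
      exact ht
  set B : ℕ → Finset (Fin 4) := fun i => G i (row i + 1) with hB
  have hP : ∀ i, 0 ≤ i → i ≤ m - 2 → ColPart (B i) (B (i + 1)) (B (i + 2)) := by
    intro i _ hi
    have he := emp i (by omega)
    have r1 : row i + 1 = row (i + 1) := (row_succ i).symm
    have r2 : row (i + 2) + 1 = row (i + 1) := by
      rw [show i + 2 = i + 1 + 1 from rfl, row_succ (i + 1), fin2_add]
    have hdom := hT.toCyc.dom i (row (i + 1)) he
    have hcd := hT.toCyc.dcard i (row (i + 1)) (by rw [he]; rfl)
    have w0 := colW_eq (G i) (row (i + 1))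
    have w1 := colW_eq (G (i + 1)) (row (i + 1))
    have w2 := colW_eq (G (i + 2)) (row (i + 1))
    have z : (G (i + 1) (row (i + 1))).card = 0 := by rw [he]; rfl
    simp only [hB]
    rw [r1, r2]
    refine ⟨hdom, ?_⟩
    by_cases h0 : i = 0
    · have := f05.1
      have q := g0 (row (i + 1) + 1)
      rw [← h0] at this
      have q' : 0 < (G i (row (i + 1) + 1)).card := by rw [h0] at *; exact q
      unfold tri at this
      omega
    · by_cases h2 : i = m - 2
      · have := f05.2
        have q := g0 (row (i + 1) + 1)
        rw [← gm, show m = i + 2 by omega] at q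
        rw [← h2] at this
        unfold tri at this
        omega
      · have := hother i (by omega) h0 h2
        unfold tri at this
        omega
  have e1 := part_period hP 1 ((m - 1) / 3) (by omega) (by omega)
  rw [show 1 + 3 * ((m - 1) / 3) = m by omega] at e1
  have e2 : B m = B 0 := by
    simp only [hB, gm]
    congr 2
    simp only [hrow]
    rw [if_neg (by omega), if_neg (by omega)]
  obtain ⟨d, _, _⟩ := part_facts (hP 0 le_rfl (by omega))
  exact disj_self d (by rw [← e2]; exact e1) (g0 _)

end

lemma Cyc.lower {m : ℕ} {F : ℕ → Fin 2 → Finset (Fin 4)} (h : Cyc m F) (hm : 3 ≤ m) :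
    4 * m + (if m % 6 = 0 ∨ m % 6 = 1 then 0 else 3) ≤ 3 * ∑ i ∈ range m, colW (F i) := by
  have h0 := h.discharge
  by_contra hc
  have hT : Tight m F := by
    refine ⟨h, hm, ?_⟩
    split_ifs at hc <;> omega
  have hu := hT.ub
  split_ifs at hc with h6
  · omega
  by_cases hd : ∃ i, ∀ s, F i s ≠ ∅
  · obtain ⟨h1, h2⟩ := hT.double hd
    omega
  · push Not at hd
    have hs : ∀ i, ∃ s, F i s = ∅ := by
      intro i
      obtain ⟨s, hs⟩ := hd i
      exact ⟨s, by simpa using hs⟩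
    have hcase : 3 * ∑ i ∈ range m, colW (F i) = 4 * m ∨
        3 * ∑ i ∈ range m, colW (F i) = 4 * m + 1 ∨
        3 * ∑ i ∈ range m, colW (F i) = 4 * m + 2 := by omega
    rcases hcase with he | he | he
    · have := hT.parity hs
      rw [Nat.even_iff] at this
      omega
    · exact hT.single_one hs he
    · exact hT.single_two hs he

lemma lower_s16 {m : ℕ} (hm : 3 ≤ m) (f : Fin m × Fin 2 → Finset (Fin 4))
    (hf : IsKRDF (prismGraph m) 4 f) :
    4 * m + (if m % 6 = 0 ∨ m % 6 = 1 then 0 else 3) ≤ 3 * rdfWeight f := by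
  have hpos : 0 < m := by omega
  set F : ℕ → Fin 2 → Finset (Fin 4) := fun i s => f (⟨i % m, Nat.mod_lt _ hpos⟩, s) with hF
  have hC : Cyc m F := by
    constructor
    · intro i s
      simp only [hF, Nat.add_mod_right]
    · intro i s hs
      rw [Finset.eq_univ_iff_forall]
      intro x
      obtain ⟨⟨j, t⟩, hadj, hx⟩ := hf _ hs x
      rw [prism_adj_iff] at hadj
      simp only [Finset.mem_union]
      rcases hadj with ⟨h1 | h1, h2⟩ | ⟨h1, h2⟩
      · rw [fin_sub_val_eq_one hm] at h1
        simp only at h1 h2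
        left; left
        have : j.val = i % m := by
          have hj := j.isLt
          have h3 : (i + 1) ≡ (j.val + 1) [MOD m] := by
            unfold Nat.ModEq; exact h1
          have h4 := Nat.ModEq.add_right_cancel' 1 h3
          unfold Nat.ModEq at h4
          rw [Nat.mod_eq_of_lt hj] at h4
          exact h4.symm
        simp only [hF]
        rw [h2]
        convert hx using 4
        exact this.symm
      · rw [fin_sub_val_eq_one hm] at h1
        simp only at h1 h2
        right
        simp only [hF]
        rw [h2]
        convert hx using 4
        rw [h1, Nat.mod_add_mod]
      · simp only at h1 h2
        left; right
        simp only [hF]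
        have : t = s + 1 := fin2_eq_succ s t h1
        rw [← this, h2]
        exact hx
  have hw : rdfWeight f = ∑ i ∈ range m, colW (F i) := by
    unfold rdfWeight
    rw [Fintype.sum_prod_type, Finset.sum_range]
    apply Finset.sum_congr rfl
    intro i _
    simp [colW, Fin.sum_univ_two, hF, Nat.mod_eq_of_lt i.isLt]
  rw [hw]
  exact hC.lower hm

/-- For `m ≥ 3`, `γ_r4(Pr(m)) = ⌈4m/3⌉` if `m ≡ 0, 1 (mod 6)` and
`γ_r4(Pr(m)) = ⌈4m/3⌉ + 1` if `m ≡ 2, 3, 4, 5 (mod 6)`. -/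
theorem stmt_16 (m : ℕ) (hm : 3 ≤ m) :
    (rainbowDomNum (prismGraph m) 4 : ℤ) =
      ⌈(4 * (m : ℚ)) / 3⌉ + (if m % 6 = 0 ∨ m % 6 = 1 then 0 else 1) := by
  obtain ⟨f, hf, hw⟩ := upper m (m / 6) (m % 6) (Nat.mod_lt _ (by omega)) hm (by omega)
  have hmem : rdfWeight f ∈ {w : ℕ | ∃ f : Fin m × Fin 2 → Finset (Fin 4),
      IsKRDF (prismGraph m) 4 f ∧ rdfWeight f = w} := ⟨f, hf, rfl⟩
  have h1 : rainbowDomNum (prismGraph m) 4 ≤ rdfWeight f := Nat.sInf_le hmem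
  have h2 : 4 * m + (if m % 6 = 0 ∨ m % 6 = 1 then 0 else 3) ≤
      3 * rainbowDomNum (prismGraph m) 4 := by
    obtain ⟨g, hg, hgw⟩ := Nat.sInf_mem (⟨_, hmem⟩ : Set.Nonempty _)
    have := lower_s16 hm g hg
    rw [hgw] at this
    exact this
  generalize rainbowDomNum (prismGraph m) 4 = N at h1 h2
  have hceil : ⌈(4 * (m : ℚ)) / 3⌉ = ((4 * m + 2) / 3 : ℤ) := by
    rw [Int.ceil_eq_iff]
    have a1 : 3 * ((4 * m + 2) / 3 : ℤ) ≤ 4 * m + 2 := by omega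
    have a2 : (4 * m : ℤ) ≤ 3 * ((4 * m + 2) / 3 : ℤ) := by omega
    have b1 : (3 : ℚ) * (((4 * m + 2) / 3 : ℤ) : ℚ) ≤ 4 * m + 2 := by exact_mod_cast a1
    have b2 : (4 * m : ℚ) ≤ 3 * (((4 * m + 2) / 3 : ℤ) : ℚ) := by exact_mod_cast a2
    constructor
    · rw [lt_div_iff₀ (by norm_num)]; linarith
    · rw [div_le_iff₀ (by norm_num)]; linarith
  rw [hceil]
  split_ifs at hw h2 ⊢ <;> omega
end

section
/- Let m ≥ 3 and let G = Pr(m) be the m-sided prism graph (the Cartesian/box product of the cycle C_m with K_2), a cubic graph of order n = 2m. Then γ_r5(G) = ⌈5m/3⌉ if m ≡ 0, 1, 2 or 5 (mod 6), and γ_r5(G) = ⌈5m/3⌉ + 1 if m ≡ 3 or 4 (mod 6). -/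
open SimpleGraph Finset

namespace Prism5

/-- Weight-like quantity of a color set: `6|s| - 5` for nonempty sets, `0` for the empty set. -/
def gw (s : Finset (Fin 5)) : ℤ := if s = ∅ then 0 else 6 * (s.card : ℤ) - 5

/-- `15` for the empty set, `0` otherwise. -/
def zw (s : Finset (Fin 5)) : ℤ := if s = ∅ then 15 else 0

lemma gw_zw (s : Finset (Fin 5)) : 3 * gw s - zw s = 18 * (s.card : ℤ) - 15 := by
  unfold gw zw
  split_ifs with h
  · simp [h]
  · ring

lemma gw_nonneg (s : Finset (Fin 5)) : 0 ≤ gw s := by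
  unfold gw
  split_ifs with h
  · rfl
  · have := Finset.card_pos.2 (Finset.nonempty_iff_ne_empty.2 h)
    omega

lemma gw_pos {s : Finset (Fin 5)} (h : s ≠ ∅) : 1 ≤ gw s := by
  unfold gw
  rw [if_neg h]
  have := Finset.card_pos.2 (Finset.nonempty_iff_ne_empty.2 h)
  omega

lemma gw_ge (s : Finset (Fin 5)) : 6 * (s.card : ℤ) - 5 ≤ gw s := by
  unfold gw
  split_ifs with h
  · simp [h]
  · rfl

lemma gw_empty : gw ∅ = 0 := by simp [gw]
lemma zw_empty : zw ∅ = 15 := by simp [zw]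
lemma gw_ne {s : Finset (Fin 5)} (h : s ≠ ∅) : gw s = 6 * (s.card : ℤ) - 5 := by simp [gw, h]
lemma zw_ne {s : Finset (Fin 5)} (h : s ≠ ∅) : zw s = 0 := by simp [zw, h]

/-- Three sets cover all colors. -/
def Cov (A B C : Finset (Fin 5)) : Prop := ∀ c, c ∈ A ∨ c ∈ B ∨ c ∈ C

lemma Cov.card {A B C : Finset (Fin 5)} (h : Cov A B C) : 5 ≤ A.card + B.card + C.card := by
  have h1 : (Finset.univ : Finset (Fin 5)) = A ∪ B ∪ C := by
    ext c; have := h c; simp; tauto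
  have h2 := Finset.card_union_le (A ∪ B) C
  have h3 := Finset.card_union_le A B
  rw [← h1] at h2
  simp at h2
  omega

lemma Cov.eq {A B C : Finset (Fin 5)} (h : Cov A B C) (hc : A.card + B.card + C.card ≤ 5) :
    A = (B ∪ C)ᶜ := by
  symm
  apply Finset.eq_of_subset_of_card_le
  · intro c hcc
    have := h c
    simp at hcc
    tauto
  · rw [Finset.card_compl]
    have h3 := Finset.card_union_le B C
    simp
    omega

lemma Cov.rot {A B C : Finset (Fin 5)} (h : Cov A B C) : Cov C A B := by
  intro c; have := h c; tauto

lemma chain (X : ℕ → Finset (Fin 5)) (k : ℕ)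
    (hcov : ∀ i, i + 1 < 3 * k + 1 → Cov (X i) (X (i + 1)) (X (i + 2)))
    (hcard : ∀ i, i + 1 < 3 * k + 1 → (X i).card + (X (i + 1)).card + (X (i + 2)).card ≤ 5)
    (hk : 1 ≤ k) (h0 : X 0 ≠ ∅) (hX : X (3 * k + 1) = X 0) : False := by
  have per : ∀ i, i + 2 < 3 * k + 1 → X (i + 3) = X i := by
    intro i hi
    have e1 := (hcov i (by omega)).eq (hcard i (by omega))
    have e2 := (hcov (i + 1) (by omega)).rot.eq (by have := hcard (i + 1) (by omega); omega)
    rw [e1]; exact e2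
  have hj : ∀ j, j ≤ k → X (3 * j + 1) = X 1 := by
    intro j
    induction j with
    | zero => intro _; rfl
    | succ j ih =>
      intro h
      rw [← ih (by omega), ← per (3 * j + 1) (by omega)]
      congr 1
  have h1 : X 0 = X 1 := by rw [← hX, hj k le_rfl]
  have e1 := (hcov 0 (by omega)).eq (hcard 0 (by omega))
  obtain ⟨c, hc⟩ := Finset.nonempty_iff_ne_empty.2 h0
  have hc2 := hc
  rw [e1] at hc2
  simp at hc2
  rw [h1] at hc
  exact hc2.1 hc

section lower
variable {m : ℕ}

/-- Domination of the empty vertices on the `a` side. -/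
def Dom (a b : ZMod m → Finset (Fin 5)) : Prop :=
  ∀ i, a i = ∅ → Cov (a (i - 1)) (a (i + 1)) (b i)

/-- Excess charge of the `a` vertex in column `i`. -/
def ex (a b : ZMod m → Finset (Fin 5)) (i : ZMod m) : ℤ :=
  gw (a (i - 1)) + gw (a (i + 1)) + gw (b i) - zw (a i)

lemma ex_nonneg {a b : ZMod m → Finset (Fin 5)} (h : Dom a b) (i : ZMod m) : 0 ≤ ex a b i := by
  unfold ex
  by_cases hi : a i = ∅
  · have := (h i hi).card
    have h1 := gw_ge (a (i - 1))
    have h2 := gw_ge (a (i + 1))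
    have h3 := gw_ge (b i)
    rw [hi, zw_empty]
    omega
  · rw [zw_ne hi]
    have h1 := gw_nonneg (a (i - 1))
    have h2 := gw_nonneg (a (i + 1))
    have h3 := gw_nonneg (b i)
    omega

lemma ex_five {a b : ZMod m → Finset (Fin 5)} (h : Dom a b) (i : ZMod m) (hi : a i = ∅)
    (hn : a (i - 1) = ∅ ∨ a (i + 1) = ∅ ∨ b i = ∅) : 5 ≤ ex a b i := by
  unfold ex
  have := (h i hi).card
  have h1 := gw_ge (a (i - 1))
  have h2 := gw_ge (a (i + 1))
  have h3 := gw_ge (b i)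
  rw [hi, zw_empty]
  rcases hn with hn | hn | hn <;> simp only [hn, gw_empty, Finset.card_empty] at * <;> omega

lemma ex_ne {a b : ZMod m → Finset (Fin 5)} (i : ZMod m) (hi : a i ≠ ∅) :
    ex a b i = gw (a (i - 1)) + gw (a (i + 1)) + gw (b i) := by
  unfold ex; rw [zw_ne hi]; ring

lemma ex_full {a b : ZMod m → Finset (Fin 5)} (i : ZMod m) (hi : a i = ∅)
    (h1 : a (i - 1) ≠ ∅) (h2 : a (i + 1) ≠ ∅) (h3 : b i ≠ ∅) :
    ex a b i = 6 * ((a (i - 1)).card + (a (i + 1)).card + (b i).card : ℤ) - 30 := by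
  unfold ex; rw [hi, zw_empty, gw_ne h1, gw_ne h2, gw_ne h3]; ring

lemma sum_ex [NeZero m] (a b : ZMod m → Finset (Fin 5)) :
    ∑ i, (ex a b i + ex b a i) =
      18 * (∑ i, (((a i).card : ℤ) + ((b i).card : ℤ))) - 30 * (m : ℤ) := by
  have s1 : ∀ f : ZMod m → ℤ, ∑ i, f (i - 1) = ∑ i, f i :=
    fun f => Equiv.sum_comp (Equiv.subRight (1 : ZMod m)) f
  have s2 : ∀ f : ZMod m → ℤ, ∑ i, f (i + 1) = ∑ i, f i :=
    fun f => Equiv.sum_comp (Equiv.addRight (1 : ZMod m)) f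
  have e : ∑ i, (ex a b i + ex b a i) =
      ∑ i, ((3 * gw (a i) - zw (a i)) + (3 * gw (b i) - zw (b i))) := by
    unfold ex
    simp only [Finset.sum_add_distrib, Finset.sum_sub_distrib, ← Finset.mul_sum]
    rw [s1 (fun i => gw (a i)), s2 (fun i => gw (a i)), s1 (fun i => gw (b i)),
      s2 (fun i => gw (b i))]
    ring
  rw [e]
  simp only [gw_zw]
  simp only [Finset.sum_add_distrib, Finset.sum_sub_distrib, ← Finset.mul_sum]
  simp [ZMod.card]
  ring

/-- Final contradiction from a special column `j`. -/
lemma final {a b : ZMod m → Finset (Fin 5)} (ha : Dom a b) (hb : Dom b a)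
    (k : ℕ) (hk : 1 ≤ k) (hmk : m = 3 * k + 1) (hev : m % 2 = 0)
    (j : ZMod m)
    (hnb : ∀ i, a i = ∅ → a (i + 1) ≠ ∅) (hnb' : ∀ i, b i = ∅ → b (i + 1) ≠ ∅)
    (hr : ∀ i, a i = ∅ → b i ≠ ∅)
    (hC : ∀ i, i ≠ j → a i = ∅ ∨ b i = ∅)
    (hxa : ∀ i, i ≠ j → ex a b i ≤ 5) (hxb : ∀ i, i ≠ j → ex b a i ≤ 5)
    (h1 : b (j + 1) = ∅) : False := by
  have hne : ∀ n : ℕ, 1 ≤ n → n < m → (j + n : ZMod m) ≠ j := by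
    intro n h1 h2 h
    have h3 : ((n : ℕ) : ZMod m) = 0 := by simpa using h
    rw [ZMod.natCast_eq_zero_iff] at h3
    exact absurd (Nat.le_of_dvd (by omega) h3) (by omega)
  have hm1 : ∀ i, a i = ∅ → a (i - 1) ≠ ∅ := by
    intro i hi h
    exact hnb _ h (by simpa using hi)
  have hm1' : ∀ i, b i = ∅ → b (i - 1) ≠ ∅ := by
    intro i hi h
    exact hnb' _ h (by simpa using hi)
  have alt : ∀ n : ℕ, n + 1 < m →
      ((n + 1) % 2 = 1 → b (j + ((n + 1 : ℕ) : ZMod m)) = ∅) ∧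
      ((n + 1) % 2 = 0 → a (j + ((n + 1 : ℕ) : ZMod m)) = ∅) := by
    intro n
    induction n with
    | zero => intro _; simpa using h1
    | succ n ih =>
      intro h
      obtain ⟨i1, i2⟩ := ih (by omega)
      have hc := hC _ (hne (n + 1 + 1) (by omega) h)
      have e : (j + ((n + 1 + 1 : ℕ) : ZMod m)) = (j + ((n + 1 : ℕ) : ZMod m)) + 1 := by
        push_cast; ring
      constructor
      · intro hp
        have := hnb _ (i2 (by omega))
        rw [← e] at this
        tauto
      · intro hp
        have := hnb' _ (i1 (by omega))
        rw [← e] at this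
        tauto
  have key : ∀ i, i + 1 < m → ∀ X : ℕ → Finset (Fin 5),
      (X = fun n : ℕ => if n % 2 = 1 then a (j + (n : ZMod m)) else b (j + (n : ZMod m))) →
      Cov (X i) (X (i + 1)) (X (i + 2)) ∧
        (X i).card + (X (i + 1)).card + (X (i + 2)).card ≤ 5 := by
    intro i hi X hX
    have e1 : (j + (i : ZMod m)) = (j + ((i + 1 : ℕ) : ZMod m)) - 1 := by push_cast; ring
    have e2 : (j + ((i + 2 : ℕ) : ZMod m)) = (j + ((i + 1 : ℕ) : ZMod m)) + 1 := by
      push_cast; ring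
    have hn := hne (i + 1) (by omega) hi
    obtain ⟨p1, p2⟩ := alt i hi
    rcases Nat.mod_two_eq_zero_or_one i with hp | hp
    · have q1 : (i + 1) % 2 = 1 := by omega
      have q2 : (i + 2) % 2 = 0 := by omega
      have hbe := p1 q1
      simp only [hX, hp, q1, q2, if_true, e1, e2]
      generalize (j + ((i + 1 : ℕ) : ZMod m)) = t at *
      have hx := hxb t hn
      have hat : a t ≠ ∅ := fun h => hr t h hbe
      rw [ex_full t hbe (hm1' t hbe) (hnb' t hbe) hat] at hx
      have := hb t hbe
      refine ⟨fun c => ?_, ?_⟩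
      · have := this c
        simp; tauto
      · simp; omega
    · have q1 : (i + 1) % 2 = 0 := by omega
      have q2 : (i + 2) % 2 = 1 := by omega
      have hbe := p2 q1
      simp only [hX, hp, q1, q2, if_true, e1, e2]
      generalize (j + ((i + 1 : ℕ) : ZMod m)) = t at *
      have hx := hxa t hn
      rw [ex_full t hbe (hm1 t hbe) (hnb t hbe) (hr t hbe)] at hx
      have := ha t hbe
      refine ⟨fun c => ?_, ?_⟩
      · have := this c
        simp; tauto
      · simp; omega
  refine chain (fun n : ℕ => if n % 2 = 1 then a (j + (n : ZMod m)) else b (j + (n : ZMod m))) k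
    (fun i hi => (key i (by omega) _ rfl).1) (fun i hi => (key i (by omega) _ rfl).2) hk ?_ ?_
  · have := hm1' _ h1
    simpa using this
  · rw [← hmk]
    simp [hev]

lemma lower [NeZero m] {a b : ZMod m → Finset (Fin 5)} (ha : Dom a b) (hb : Dom b a)
    (hm : 3 ≤ m) :
    5 * m ≤ 3 * ∑ i, ((a i).card + (b i).card) ∧
    (m % 6 = 3 ∨ m % 6 = 4 → 5 * m + 1 < 3 * ∑ i, ((a i).card + (b i).card)) := by
  have hs := sum_ex a b
  have hcast : (∑ i, (((a i).card : ℤ) + ((b i).card : ℤ))) =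
      ((∑ i, ((a i).card + (b i).card) : ℕ) : ℤ) := by push_cast; rfl
  rw [hcast] at hs
  generalize (∑ i, ((a i).card + (b i).card)) = W at *
  have hnn : ∀ i, 0 ≤ ex a b i + ex b a i := fun i =>
    add_nonneg (ex_nonneg ha i) (ex_nonneg hb i)
  have htot : 0 ≤ ∑ i, (ex a b i + ex b a i) := Finset.sum_nonneg fun i _ => hnn i
  refine ⟨by omega, ?_⟩
  intro hm6
  by_contra hlt
  have htot6 : ∑ i, (ex a b i + ex b a i) ≤ 6 := by omega
  have hone : ∀ i, ex a b i + ex b a i ≤ ∑ i, (ex a b i + ex b a i) := fun i =>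
    Finset.single_le_sum (f := fun i => ex a b i + ex b a i) (fun i _ => hnn i) (Finset.mem_univ i)
  have htwo : ∀ i j, i ≠ j →
      (ex a b i + ex b a i) + (ex a b j + ex b a j) ≤ 6 := by
    intro i j hij
    refine le_trans ?_ htot6
    rw [← Finset.sum_pair (f := fun i => ex a b i + ex b a i) hij]
    exact Finset.sum_le_sum_of_subset_of_nonneg (Finset.subset_univ _) fun i _ _ => hnn i
  have hone1 : ∀ i : ZMod m, i ≠ i + 1 := by
    intro i h
    have h3 : ((1 : ℕ) : ZMod m) = 0 := by simpa using h
    rw [ZMod.natCast_eq_zero_iff] at h3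
    exact absurd (Nat.le_of_dvd (by omega) h3) (by omega)
  have na := ex_nonneg ha
  have nb := ex_nonneg hb
  have hr : ∀ i, a i = ∅ → b i ≠ ∅ := by
    intro i h h'
    have h1 := ex_five ha i h (by tauto)
    have h2 := ex_five hb i h' (by tauto)
    have := hone i
    omega
  have hnb : ∀ i, a i = ∅ → a (i + 1) ≠ ∅ := by
    intro i h h'
    have h1 := ex_five ha i h (by tauto)
    have h2 := ex_five ha (i + 1) h' (by left; simpa using h)
    have := htwo i (i + 1) (hone1 i)
    have := nb i
    have := nb (i + 1)
    omega
  have hnb' : ∀ i, b i = ∅ → b (i + 1) ≠ ∅ := by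
    intro i h h'
    have h1 := ex_five hb i h (by tauto)
    have h2 := ex_five hb (i + 1) h' (by left; simpa using h)
    have := htwo i (i + 1) (hone1 i)
    have := na i
    have := na (i + 1)
    omega
  have hcol : ∀ i, 0 ≤ gw (a i) + gw (b i) ∧ 1 ≤ gw (a i) + gw (b i) := by
    intro i
    have h1 := gw_nonneg (a i)
    have h2 := gw_nonneg (b i)
    by_cases h : a i = ∅
    · have := gw_pos (hr i h); omega
    · have := gw_pos h; omega
  have hfour : ∀ i, a i ≠ ∅ → b i ≠ ∅ → 4 ≤ ex a b i + ex b a i := by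
    intro i h1 h2
    rw [ex_ne i h1, ex_ne i h2]
    have := gw_pos h1
    have := gw_pos h2
    have := (hcol (i - 1)).2
    have := (hcol (i + 1)).2
    omega
  by_cases hm3 : m % 6 = 3
  · -- odd case: the excess vanishes
    have h0 : ∑ i, (ex a b i + ex b a i) = 0 := by omega
    have hC : ∀ i, a i = ∅ ∨ b i = ∅ := by
      intro i
      by_contra h
      push Not at h
      have := hfour i (Finset.nonempty_iff_ne_empty.1 h.1) (Finset.nonempty_iff_ne_empty.1 h.2)
      have := hone i
      omega
    have step : ∀ i, a (i + 1) = ∅ ↔ a i ≠ ∅ := by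
      intro i
      constructor
      · intro h h'; exact hnb i h' h
      · intro h
        have h1 := (hC i).resolve_left h
        exact (hC (i + 1)).resolve_right (hnb' i h1)
    have alt : ∀ n : ℕ, a ((2 * n : ℕ) : ZMod m) = ∅ ↔ a 0 = ∅ := by
      intro n
      induction n with
      | zero => simp
      | succ n ih =>
        have e : ((2 * (n + 1) : ℕ) : ZMod m) = ((2 * n : ℕ) : ZMod m) + 1 + 1 := by
          push_cast; ring
        rw [e, step, ne_eq, step, not_not, ih]
    have h2 := alt ((m - 1) / 2)
    have h3 := step ((2 * ((m - 1) / 2) : ℕ) : ZMod m)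
    have e : ((2 * ((m - 1) / 2) : ℕ) : ZMod m) + 1 = 0 := by
      have : ((2 * ((m - 1) / 2) + 1 : ℕ) : ZMod m) = 0 := by
        rw [show 2 * ((m - 1) / 2) + 1 = m by omega]; simp
      rw [← this]; push_cast; ring
    rw [e] at h3
    tauto
  · have hm4 : m % 6 = 4 := by tauto
    obtain ⟨j, hjC, hj5⟩ : ∃ j : ZMod m, (∀ i, i ≠ j → a i = ∅ ∨ b i = ∅) ∧
        (∀ i, i ≠ j → ex a b i + ex b a i ≤ 5) := by
      by_cases hc : ∃ j, a j ≠ ∅ ∧ b j ≠ ∅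
      · obtain ⟨j, hj1, hj2⟩ := hc
        have h4 := hfour j hj1 hj2
        refine ⟨j, fun i hi => ?_, fun i hi => ?_⟩
        · by_contra h
          push Not at h
          have := hfour i (Finset.nonempty_iff_ne_empty.1 h.1) (Finset.nonempty_iff_ne_empty.1 h.2)
          have := htwo i j hi
          omega
        · have := htwo i j hi
          omega
      · have hC : ∀ i, a i = ∅ ∨ b i = ∅ := by
          intro i
          by_contra h
          exact hc ⟨i, by tauto, by tauto⟩
        by_cases h6 : ∃ j, 6 ≤ ex a b j + ex b a j
        · obtain ⟨j, hj⟩ := h6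
          refine ⟨j, fun i _ => hC i, fun i hi => ?_⟩
          have := htwo i j hi
          omega
        · push Not at h6
          exact ⟨0, fun i _ => hC i, fun i _ => by have := h6 i; omega⟩
    have hxa : ∀ i, i ≠ j → ex a b i ≤ 5 := fun i hi => by
      have := hj5 i hi; have := nb i; omega
    have hxb : ∀ i, i ≠ j → ex b a i ≤ 5 := fun i hi => by
      have := hj5 i hi; have := na i; omega
    have hk : m = 3 * (m / 3) + 1 := by omega
    rcases hjC (j + 1) (hone1 j).symm with h | h
    · exact final hb ha (m / 3) (by omega) hk (by omega) j hnb' hnb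
        (fun i h1 h2 => hr i h2 h1) (fun i hi => (hjC i hi).symm) hxb hxa h
    · exact final ha hb (m / 3) (by omega) hk (by omega) j hnb hnb' hr hjC hxa hxb h

end lower

/-- Columns of the construction: positions `0..5` form the periodic block, positions `6..` the
tail of length `r`. -/
def colF (r p : ℕ) (s : Fin 2) : Finset (Fin 5) :=
  match p with
  | 0 => ![{0}, ∅] s
  | 1 => ![∅, {1, 2, 3}] s
  | 2 => ![{4}, ∅] s
  | 3 => ![∅, {0}] s
  | 4 => ![{1, 2, 3}, ∅] s
  | 5 => ![∅, {4}] s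
  | 6 => if r = 1 then ![{0}, {4}] s else if r = 2 then ![{0}, {0}] s else ![{0}, ∅] s
  | 7 => if r = 2 then ![{0}, {4}] s else ![∅, {1, 2, 3}] s
  | 8 => if r = 3 then ![{4}, {4}] s else ![{4}, ∅] s
  | 9 => if r = 4 then ![{0}, {0, 4}] s else ![{0}, {0}] s
  | _ => ![{0}, {4}] s

/-- Allowed consecutive positions. -/
def stp (r x y : ℕ) : Prop :=
  (y = x + 1) ∨ (x = 5 ∧ y = 0) ∨ (x + 1 = 6 + r ∧ y = 0) ∨ (3 ≤ r ∧ x + 1 = 6 + r ∧ y = 6)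

instance (r x y : ℕ) : Decidable (stp r x y) := by unfold stp; infer_instance

/-- Column `y` is dominated given neighbouring columns `x` and `z`. -/
def Good (r x y z : ℕ) : Prop :=
  ∀ s : Fin 2, colF r y s = ∅ →
    ∀ c : Fin 5, c ∈ colF r x s ∨ c ∈ colF r z s ∨ c ∈ colF r y (s + 1)

instance (r x y z : ℕ) : Decidable (Good r x y z) := by unfold Good; infer_instance

set_option synthInstance.maxHeartbeats 400000 in
set_option synthInstance.maxSize 2000 in
lemma colF_good : ∀ r < 6, ∀ y < 6 + r, ∀ x < 6 + r, ∀ z < 6 + r, stp r x y → stp r y z →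
    Good r x y z := by
  decide +kernel

/-- Position of column `i`. -/
def pos (k i : ℕ) : ℕ := if i < 6 * k then i % 6 else 6 + (i - 6 * k)

lemma pos_lt {k r i : ℕ} (h : i < 6 * k + r) : pos k i < 6 + r := by
  unfold pos; split_ifs <;> omega

lemma pos_step {k r i : ℕ} (h : i + 1 < 6 * k + r) :
    stp r (pos k i) (pos k (i + 1)) := by
  unfold pos stp; split_ifs <;> omega

lemma pos_last {k r : ℕ} (hm : 3 ≤ 6 * k + r) :
    stp r (pos k (6 * k + r - 1)) (pos k 0) := by
  unfold pos stp; split_ifs <;> omega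

/-- Weight of the tail. -/
def tw (r : ℕ) : ℕ := ![0, 2, 4, 6, 8, 9] (Fin.ofNat 6 r)

/-- Column weight. -/
def cw (r p : ℕ) : ℕ := (colF r p 0).card + (colF r p 1).card

lemma tail_weight : ∀ r < 6, ∑ j ∈ Finset.range r, cw r (6 + j) = tw r := by
  decide +kernel

lemma block_weight : ∀ r < 6, cw r 0 = 1 ∧ cw r 1 = 3 ∧ cw r 2 = 1 ∧ cw r 3 = 1 ∧ cw r 4 = 3 ∧
    cw r 5 = 1 := by
  decide +kernel

lemma weight (k r : ℕ) (hr : r < 6) :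
    ∑ i ∈ Finset.range (6 * k + r), cw r (pos k i) = 10 * k + tw r := by
  rw [Finset.sum_range_add]
  have h1 : ∀ j ∈ Finset.range r, cw r (pos k (6 * k + j)) = cw r (6 + j) := by
    intro j _
    unfold pos
    simp
  rw [Finset.sum_congr rfl h1, tail_weight r hr]
  have h2 : ∀ i ∈ Finset.range (6 * k), cw r (pos k i) = cw r (i % 6) := by
    intro i hi
    rw [Finset.mem_range] at hi
    unfold pos
    simp [hi]
  rw [Finset.sum_congr rfl h2]
  congr 1
  clear h1 h2
  obtain ⟨b0, b1, b2, b3, b4, b5⟩ := block_weight r hr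
  induction k with
  | zero => simp
  | succ k ih =>
    rw [show 6 * (k + 1) = 6 * k + 6 by ring, Finset.sum_range_add, ih]
    simp [Finset.sum_range_succ, Nat.add_mod, b0, b1, b2, b3, b4, b5]
    ring

lemma adj_iff (n : ℕ) (i j : ZMod (n + 3)) (s t : Fin 2) :
    (prismGraph (n + 3)).Adj ((i, s) : Fin (n + 3) × Fin 2) ((j, t) : Fin (n + 3) × Fin 2) ↔
      ((j = i - 1 ∨ j = i + 1) ∧ s = t) ∨ (i = j ∧ t = s + 1) := by
  unfold prismGraph
  rw [SimpleGraph.boxProd_adj]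
  have h1 : (SimpleGraph.cycleGraph (n + 3)).Adj i j ↔ (j = i - 1 ∨ j = i + 1) := by
    refine (SimpleGraph.cycleGraph_adj (n := n + 1) (u := i) (v := j)).trans ?_
    have e1 : ((i : Fin (n + 3)) - j = 1) ↔ (i - j = (1 : ZMod (n + 3))) := Iff.rfl
    have e2 : ((j : Fin (n + 3)) - i = 1) ↔ (j - i = (1 : ZMod (n + 3))) := Iff.rfl
    refine (or_congr e1 e2).trans ?_
    constructor
    · rintro (h | h)
      · left; rw [← h]; ring
      · right; rw [← h]; ring
    · rintro (h | h)
      · left; rw [h]; ring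
      · right; rw [h]; ring
  have h2 : (⊤ : SimpleGraph (Fin 2)).Adj s t ↔ t = s + 1 := by
    rw [SimpleGraph.top_adj]
    revert s t; decide
  constructor
  · rintro (⟨h, h'⟩ | ⟨h, h'⟩)
    · exact Or.inl ⟨h1.1 h, h'⟩
    · exact Or.inr ⟨h', h2.1 h⟩
  · rintro (⟨h, h'⟩ | ⟨h, h'⟩)
    · exact Or.inl ⟨h1.2 h, h'⟩
    · exact Or.inr ⟨h2.2 h', h⟩

lemma weight_eq (n : ℕ) (f : Fin (n + 3) × Fin 2 → Finset (Fin 5)) :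
    rdfWeight f = ∑ i : ZMod (n + 3), ((f (i, 0)).card + (f (i, 1)).card) := by
  unfold rdfWeight
  rw [Fintype.sum_prod_type]
  simp only [Fin.sum_univ_two]
  rfl

lemma lower_rdf (n : ℕ) (f : Fin (n + 3) × Fin 2 → Finset (Fin 5))
    (hf : IsKRDF (prismGraph (n + 3)) 5 f) :
    5 * (n + 3) ≤ 3 * rdfWeight f ∧
    ((n + 3) % 6 = 3 ∨ (n + 3) % 6 = 4 → 5 * (n + 3) + 1 < 3 * rdfWeight f) := by
  rw [weight_eq]
  have key : ∀ s : Fin 2, ∀ i : ZMod (n + 3), f (i, s) = ∅ →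
      Cov (f ((i - 1 : ZMod (n + 3)), s)) (f ((i + 1 : ZMod (n + 3)), s)) (f (i, s + 1)) := by
    intro s i h c
    obtain ⟨⟨j, t⟩, hadj, hc⟩ := hf (i, s) h c
    rcases (adj_iff n i j s t).1 hadj with ⟨h1 | h1, h2⟩ | ⟨h1, h2⟩
    · subst h1 h2; exact Or.inl hc
    · subst h1 h2; exact Or.inr (Or.inl hc)
    · subst h1 h2; exact Or.inr (Or.inr hc)
  exact lower (m := n + 3) (a := fun i => f (i, 0)) (b := fun i => f (i, 1))
    (fun i h => key 0 i h) (fun i h => key 1 i h) (by omega)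

lemma upper_rdf (n k r : ℕ) (hr : r < 6) (hn : n + 3 = 6 * k + r) :
    ∃ f : Fin (n + 3) × Fin 2 → Finset (Fin 5),
      IsKRDF (prismGraph (n + 3)) 5 f ∧ rdfWeight f = 10 * k + tw r := by
  refine ⟨fun v => colF r (pos k v.1.val) v.2, ?_, ?_⟩
  · rintro ⟨i, s⟩ h c
    have hlt : ∀ i : Fin (n + 3), pos k i.val < 6 + r := fun i => pos_lt (by have := i.2; omega)
    have hstep : ∀ i : Fin (n + 3), stp r (pos k i.val) (pos k (i + 1).val) := by
      intro i
      rw [Fin.val_add_one]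
      split_ifs with h
      · have := pos_last (k := k) (r := r) (by omega)
        rw [h]
        simpa [← hn] using this
      · have hi := i.2
        refine pos_step ?_
        have : i.val ≠ n + 2 := fun h' => h (Fin.ext h')
        omega
    have e : (i - 1) + 1 = i := by
      have : ∀ t : ZMod (n + 3), (t - 1) + 1 = t := fun t => by ring
      exact this i
    have h1 := hstep (i - 1)
    rw [e] at h1
    rcases colF_good r hr _ (hlt i) _ (hlt (i - 1)) _ (hlt (i + 1)) h1 (hstep i) s h c
      with hc | hc | hc
    · exact ⟨(i - 1, s), (adj_iff n i _ s s).2 (Or.inl ⟨Or.inl rfl, rfl⟩), hc⟩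
    · exact ⟨(i + 1, s), (adj_iff n i _ s s).2 (Or.inl ⟨Or.inr rfl, rfl⟩), hc⟩
    · exact ⟨(i, s + 1), (adj_iff n i i s (s + 1)).2 (Or.inr ⟨rfl, rfl⟩), hc⟩
  · rw [← weight k r hr, ← hn]
    unfold rdfWeight
    rw [Fintype.sum_prod_type]
    simp only [Fin.sum_univ_two]
    exact Fin.sum_univ_eq_sum_range (fun i => cw r (pos k i)) (n + 3)

end Prism5

/-- For `m ≥ 3`, `γ_r5(Pr(m)) = ⌈5m/3⌉` if `m ≡ 0, 1, 2, 5 (mod 6)` and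
`γ_r5(Pr(m)) = ⌈5m/3⌉ + 1` if `m ≡ 3, 4 (mod 6)`. -/
theorem stmt_17 (m : ℕ) (hm : 3 ≤ m) :
    (rainbowDomNum (prismGraph m) 5 : ℤ) =
      ⌈(5 * (m : ℚ)) / 3⌉ + (if m % 6 = 3 ∨ m % 6 = 4 then 1 else 0) := by
  obtain ⟨n, rfl⟩ : ∃ n, m = n + 3 := ⟨m - 3, by omega⟩
  have hr : (n + 3) % 6 < 6 := Nat.mod_lt _ (by norm_num)
  have hn : n + 3 = 6 * ((n + 3) / 6) + (n + 3) % 6 := by omega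
  have hup := Prism5.upper_rdf n ((n + 3) / 6) ((n + 3) % 6) hr hn
  have hle : rainbowDomNum (prismGraph (n + 3)) 5 ≤
      10 * ((n + 3) / 6) + Prism5.tw ((n + 3) % 6) := Nat.sInf_le hup
  obtain ⟨f, hf, hw⟩ : rainbowDomNum (prismGraph (n + 3)) 5 ∈
      {w : ℕ | ∃ f : Fin (n + 3) × Fin 2 → Finset (Fin 5),
        IsKRDF (prismGraph (n + 3)) 5 f ∧ rdfWeight f = w} := Nat.sInf_mem ⟨_, hup⟩
  obtain ⟨l1, l2⟩ := Prism5.lower_rdf n f hf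
  rw [hw] at l1 l2
  generalize rainbowDomNum (prismGraph (n + 3)) 5 = R at *
  have htw : Prism5.tw 0 = 0 ∧ Prism5.tw 1 = 2 ∧ Prism5.tw 2 = 4 ∧ Prism5.tw 3 = 6 ∧
      Prism5.tw 4 = 8 ∧ Prism5.tw 5 = 9 := by decide
  obtain ⟨t0, t1, t2, t3, t4, t5⟩ := htw
  have hceil : ⌈(5 * ((n + 3 : ℕ) : ℚ)) / 3⌉ = ((5 * (n + 3) + 2) / 3 : ℕ) := by
    rw [Int.ceil_eq_iff]
    have q1 : 3 * ((5 * (n + 3) + 2) / 3) < 5 * (n + 3) + 3 := by omega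
    have q2 : 5 * (n + 3) ≤ 3 * ((5 * (n + 3) + 2) / 3) := by omega
    generalize (5 * (n + 3) + 2) / 3 = q at *
    have q1' : (3 * q : ℚ) < 5 * (n + 3) + 3 := by exact_mod_cast q1
    have q2' : (5 * (n + 3) : ℚ) ≤ 3 * q := by exact_mod_cast q2
    push_cast
    constructor <;> linarith
  rw [hceil]
  have h6 : (n + 3) % 6 = 0 ∨ (n + 3) % 6 = 1 ∨ (n + 3) % 6 = 2 ∨ (n + 3) % 6 = 3 ∨
      (n + 3) % 6 = 4 ∨ (n + 3) % 6 = 5 := by omega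
  rcases h6 with h | h | h | h | h | h <;>
    simp only [h, t0, t1, t2, t3, t4, t5] at * <;> norm_num at * <;> omega
end
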